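/- arXiv:math/0605211 — 2 statements merged into one kernel-verified Lean document; each statement's English description precedes it below -/
import Mathlib

section
/- Fix η > 0, and say that (X,𝓐) satisfies property (β3^η) if there exist θ > 0, ν ≥ 8 and χ > 0 such that every (θ,ν)-fat geodesic hexagon of diameter at least η is contained in N_χ(A) for some A ∈ 𝓐. Then a geodesic metric space X satisfying properties (α1), (β2) and (β3^η) with respect to a collection 𝓐 of subsets is asymptotically tree-graded with respect to 𝓐 (i.e. (α1), (α2), (α3) hold). -/
open Set Metric

/-! ### Basic metric notions: tubular neighborhoods, geodesics -/

variable {X : Type*} [MetricSpace X]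

/-- Open `δ`-tubular neighborhood of a subset. -/
def tubN (δ : ℝ) (A : Set X) : Set X := {x | Metric.infDist x A < δ}

/-- Closed `δ`-tubular neighborhood of a subset. -/
def ctubN (δ : ℝ) (A : Set X) : Set X := {x | Metric.infDist x A ≤ δ}

/-- `γ` parametrizes a geodesic of length `ℓ` (an isometric embedding of `[0,ℓ]`). -/
def IsGeodesicParam (γ : ℝ → X) (ℓ : ℝ) : Prop :=
  0 ≤ ℓ ∧ ∀ s ∈ Set.Icc (0:ℝ) ℓ, ∀ t ∈ Set.Icc (0:ℝ) ℓ, dist (γ s) (γ t) = |s - t|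

/-- A metric space is geodesic if every two points are joined by a geodesic. -/
def GeodesicSpace (X : Type*) [MetricSpace X] : Prop :=
  ∀ x y : X, ∃ (γ : ℝ → X) (ℓ : ℝ), IsGeodesicParam γ ℓ ∧ γ 0 = x ∧ γ ℓ = y

/-- The cyclic successor of an index in `Fin k`. -/
def finCycSucc {k : ℕ} (i : Fin k) : Fin k := ⟨(i.val + 1) % k, Nat.mod_lt _ i.pos⟩

/-! ### Polygons -/

/-- The data of a `k`-gon: `k` parametrized paths with their lengths. -/
structure PrePolygon (X : Type*) (k : ℕ) where
  edge : Fin k → ℝ → X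
  len : Fin k → ℝ

namespace PrePolygon

variable {k : ℕ}

/-- The `i`-th edge, as a subset. -/
def edgeSet (P : PrePolygon X k) (i : Fin k) : Set X := P.edge i '' Set.Icc 0 (P.len i)

/-- The polygon, as a subset (union of its edges). -/
def carrier (P : PrePolygon X k) : Set X := ⋃ i, P.edgeSet i

/-- The `i`-th vertex (the origin of the `i`-th edge). -/
def vertex (P : PrePolygon X k) (i : Fin k) : X := P.edge i 0

/-- The union `O_x` of the edges not adjacent to the `i`-th vertex. -/
def opp (P : PrePolygon X k) (i : Fin k) : Set X :=
  ⋃ j ∈ {j : Fin k | j ≠ i ∧ finCycSucc j ≠ i}, P.edgeSet j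

/-- The edges close up cyclically (the endpoint of each edge is the origin of the next). -/
def IsClosedPolygon (P : PrePolygon X k) : Prop :=
  (∀ i, 0 ≤ P.len i) ∧ ∀ i, P.edge i (P.len i) = P.edge (finCycSucc i) 0

/-- A geodesic `k`-gon. -/
def IsGeodesicPolygon (P : PrePolygon X k) : Prop :=
  P.IsClosedPolygon ∧ ∀ i, IsGeodesicParam (P.edge i) (P.len i)

/-- The polygon is `(θ,σ,ν)`-fat:  (F1) every point of an edge at distance at least `σθ`
from both endpoints of the edge is at distance at least `θ` from the rest of the polygon;
(F2) every vertex is at distance at least `νθ` from the union of the non-adjacent edges. -/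
def IsFat (P : PrePolygon X k) (θ σ ν : ℝ) : Prop :=
  (∀ i : Fin k, ∀ p ∈ P.edgeSet i,
      σ * θ ≤ dist p (P.edge i 0) → σ * θ ≤ dist p (P.edge i (P.len i)) →
      θ ≤ Metric.infDist p (P.carrier \ P.edgeSet i)) ∧
  (∀ i : Fin k, ν * θ ≤ Metric.infDist (P.vertex i) (P.opp i))

/-- `(θ,ν)`-fat means `(θ,2,ν)`-fat. -/
def IsFat2 (P : PrePolygon X k) (θ ν : ℝ) : Prop := P.IsFat θ 2 ν

end PrePolygon

/-! ### Gromov hyperbolicity (thin triangles) -/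

/-- A geodesic metric space is Gromov hyperbolic if there is `δ ≥ 0` such that every geodesic
triangle is `δ`-thin: each side lies in the closed `δ`-neighborhood of the other two sides. -/
def GromovHyperbolic (X : Type*) [MetricSpace X] : Prop :=
  ∃ δ : ℝ, 0 ≤ δ ∧ ∀ T : PrePolygon X 3, T.IsGeodesicPolygon →
    ∀ i : Fin 3, ∀ p ∈ T.edgeSet i,
      Metric.infDist p (T.edgeSet (finCycSucc i) ∪ T.edgeSet (finCycSucc (finCycSucc i))) ≤ δ

/-! ### The Druţu–Sapir properties of a pair `(X, 𝓐)` -/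

/-- Property (α₁): uniformly bounded intersections of tubular neighborhoods. -/
def Alpha1 (𝓐 : Set (Set X)) : Prop :=
  ∀ δ : ℝ, 0 < δ → ∃ D : ℝ, ∀ A ∈ 𝓐, ∀ A' ∈ 𝓐, A ≠ A' →
    ∀ x ∈ tubN δ A ∩ tubN δ A', ∀ y ∈ tubN δ A ∩ tubN δ A', dist x y ≤ D

/-- Property (α₂) with given constants `ε`, `M`. -/
def Alpha2With (𝓐 : Set (Set X)) (ε M : ℝ) : Prop :=
  ∀ (γ : ℝ → X) (ℓ : ℝ), IsGeodesicParam γ ℓ → ∀ A ∈ 𝓐,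
    γ 0 ∈ tubN (ε * ℓ) A → γ ℓ ∈ tubN (ε * ℓ) A →
    ∃ t ∈ Set.Icc (0:ℝ) ℓ, γ t ∈ tubN M A

/-- Property (α₂). -/
def Alpha2 (𝓐 : Set (Set X)) : Prop :=
  ∃ ε M : ℝ, 0 ≤ ε ∧ ε < 1/2 ∧ 0 < M ∧ Alpha2With 𝓐 ε M

/-- Property (α₃): fat geodesic `k`-gons lie in tubular neighborhoods of pieces. -/
def Alpha3 (𝓐 : Set (Set X)) : Prop :=
  ∀ k : ℕ, 2 ≤ k → ∃ θ : ℝ, 0 < θ ∧ ∃ ν : ℝ, 8 ≤ ν ∧ ∃ χ : ℝ, 0 < χ ∧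
    ∀ P : PrePolygon X k, P.IsGeodesicPolygon → P.IsFat2 θ ν →
      ∃ A ∈ 𝓐, P.carrier ⊆ tubN χ A

/-- Property (β₂) with given constants `ε`, `M`: middle thirds of geodesics with endpoints
close to a piece stay close to the piece. -/
def Beta2With (𝓐 : Set (Set X)) (ε M : ℝ) : Prop :=
  ∀ (γ : ℝ → X) (ℓ : ℝ), IsGeodesicParam γ ℓ → ∀ A ∈ 𝓐,
    γ 0 ∈ tubN (ε * ℓ) A → γ ℓ ∈ tubN (ε * ℓ) A →
    ∀ t ∈ Set.Icc (ℓ/3) (2*ℓ/3), γ t ∈ tubN M A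

/-- Property (β₂). -/
def Beta2 (𝓐 : Set (Set X)) : Prop := ∃ ε M : ℝ, 0 < ε ∧ 0 ≤ M ∧ Beta2With 𝓐 ε M

/-- Property (β₃) with given constants: fat geodesic hexagons lie in tubular
neighborhoods of pieces. -/
def Beta3With (𝓐 : Set (Set X)) (θ ν χ : ℝ) : Prop :=
  ∀ P : PrePolygon X 6, P.IsGeodesicPolygon → P.IsFat2 θ ν → ∃ A ∈ 𝓐, P.carrier ⊆ tubN χ A

/-- Property (β₃). -/
def Beta3 (𝓐 : Set (Set X)) : Prop :=
  ∃ θ : ℝ, 0 < θ ∧ ∃ ν : ℝ, 8 ≤ ν ∧ ∃ χ : ℝ, 0 < χ ∧ Beta3With 𝓐 θ ν χ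

/-- Property (Q), uniform quasi-convexity of pieces, with given constants `t`, `K₀`. -/
def PropQWith (𝓐 : Set (Set X)) (t K₀ : ℝ) : Prop :=
  ∀ A ∈ 𝓐, ∀ K : ℝ, K₀ ≤ K → ∀ (γ : ℝ → X) (ℓ : ℝ), IsGeodesicParam γ ℓ →
    γ 0 ∈ tubN K A → γ ℓ ∈ tubN K A → ∀ s ∈ Set.Icc (0:ℝ) ℓ, γ s ∈ tubN (t * K) A

/-- Property (Q), uniform quasi-convexity of pieces. -/
def PropQ (𝓐 : Set (Set X)) : Prop :=
  ∃ t : ℝ, 0 < t ∧ ∃ K₀ : ℝ, 0 ≤ K₀ ∧ PropQWith 𝓐 t K₀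

/-- `X` is asymptotically tree-graded with respect to `𝓐` (Druţu–Sapir metric
characterization, taken as the definition): (α₁), (α₂) and (α₃) hold. -/
def ATG (𝓐 : Set (Set X)) : Prop := Alpha1 𝓐 ∧ Alpha2 𝓐 ∧ Alpha3 𝓐

/-! ### Entrance and exit points, almost geodesics, the (*) property -/

/-- The entrance point of the path `p : [0,ℓ] → X` in the set `S`. -/
noncomputable def entrancePoint (p : ℝ → X) (ℓ : ℝ) (S : Set X) : X :=
  p (sInf {t | t ∈ Set.Icc (0:ℝ) ℓ ∧ p t ∈ S})

/-- The exit point of the path `p : [0,ℓ] → X` from the set `S`. -/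
noncomputable def exitPoint (p : ℝ → X) (ℓ : ℝ) (S : Set X) : X :=
  p (sSup {t | t ∈ Set.Icc (0:ℝ) ℓ ∧ p t ∈ S})

/-- `q` is a `(1,C)`-almost geodesic on `[0,ℓ]`: a `1`-Lipschitz `(1,C)`-quasi-geodesic. -/
def IsAlmostGeodesic (C : ℝ) (q : ℝ → X) (ℓ : ℝ) : Prop :=
  0 ≤ ℓ ∧ ∀ s ∈ Set.Icc (0:ℝ) ℓ, ∀ t ∈ Set.Icc (0:ℝ) ℓ,
    |s - t| - C ≤ dist (q s) (q t) ∧ dist (q s) (q t) ≤ |s - t|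

/-- The `(*)` alternative for triangles with `(1,C)`-almost geodesic edges,
with constants `σ`, `δ`. -/
def StarATGWith (𝓐 : Set (Set X)) (C σ δ : ℝ) : Prop :=
  ∀ T : PrePolygon X 3, T.IsClosedPolygon →
    (∀ i, IsAlmostGeodesic C (T.edge i) (T.len i)) →
    (∃ a : X, ∀ i : Fin 3, (Metric.closedBall a σ ∩ T.edgeSet i).Nonempty) ∨
    (∃ A ∈ 𝓐, (∀ i : Fin 3, (ctubN σ A ∩ T.edgeSet i).Nonempty) ∧
      ∀ i : Fin 3, dist (exitPoint (T.edge i) (T.len i) (ctubN σ A))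
        (entrancePoint (T.edge (finCycSucc i)) (T.len (finCycSucc i)) (ctubN σ A)) < δ)

/-- `X` is `(*)`-asymptotically tree-graded with respect to `𝓐`. -/
def StarATG (𝓐 : Set (Set X)) : Prop :=
  ∀ C : ℝ, 0 ≤ C → ∃ σ δ : ℝ, StarATGWith 𝓐 C σ δ

/-- Property (β₃^η) with given constants: every `(θ,ν)`-fat geodesic hexagon of diameter
at least `η` is contained in the `χ`-neighborhood of a piece. -/
def Beta3EtaWith (𝓐 : Set (Set X)) (η θ ν χ : ℝ) : Prop :=
  ∀ P : PrePolygon X 6, P.IsGeodesicPolygon → P.IsFat2 θ ν →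
    η ≤ Metric.diam P.carrier → ∃ A ∈ 𝓐, P.carrier ⊆ tubN χ A

/-- Property (β₃^η). -/
def Beta3Eta (𝓐 : Set (Set X)) (η : ℝ) : Prop :=
  ∃ θ : ℝ, 0 < θ ∧ ∃ ν : ℝ, 8 ≤ ν ∧ ∃ χ : ℝ, 0 < χ ∧ Beta3EtaWith 𝓐 η θ ν χ

/-! ### Segments as sets -/

/-- `S` is the image of a geodesic from `x` to `y`. -/
def IsSeg (S : Set X) (x y : X) : Prop :=
  ∃ (γ : ℝ → X) (ℓ : ℝ), IsGeodesicParam γ ℓ ∧ γ 0 = x ∧ γ ℓ = y ∧ S = γ '' Set.Icc 0 ℓ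

theorem IsSeg.symm {S : Set X} {x y : X} (h : IsSeg S x y) : IsSeg S y x := by
  obtain ⟨γ, ℓ, ⟨h0, hd⟩, hx, hy, rfl⟩ := h
  refine ⟨fun t => γ (ℓ - t), ℓ, ⟨h0, ?_⟩, by simpa using hy, by simpa using hx, ?_⟩
  · intro s hs t ht
    rw [hd _ ⟨by linarith [hs.2], by linarith [hs.1]⟩ _ ⟨by linarith [ht.2], by linarith [ht.1]⟩]
    rw [abs_sub_comm]; congr 1; ring
  · ext p; constructor
    · rintro ⟨t, ht, rfl⟩
      exact ⟨ℓ - t, ⟨by linarith [ht.2], by linarith [ht.1]⟩, by simp⟩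
    · rintro ⟨t, ht, rfl⟩
      exact ⟨ℓ - t, ⟨by linarith [ht.2], by linarith [ht.1]⟩, by simp⟩

theorem IsSeg.left_mem {S : Set X} {x y : X} (h : IsSeg S x y) : x ∈ S := by
  obtain ⟨γ, ℓ, ⟨h0, hd⟩, hx, hy, rfl⟩ := h
  exact ⟨0, ⟨le_rfl, h0⟩, hx⟩

theorem IsSeg.right_mem {S : Set X} {x y : X} (h : IsSeg S x y) : y ∈ S := h.symm.left_mem

theorem IsSeg.dist_eq {S : Set X} {x y : X} (h : IsSeg S x y) {u v : X} (hu : u ∈ S) (hv : v ∈ S) :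
    dist u v = |dist x u - dist x v| := by
  obtain ⟨γ, ℓ, ⟨h0, hd⟩, rfl, rfl, rfl⟩ := h
  obtain ⟨s, hs, rfl⟩ := hu
  obtain ⟨t, ht, rfl⟩ := hv
  rw [hd s hs t ht, hd 0 ⟨le_rfl, h0⟩ s hs, hd 0 ⟨le_rfl, h0⟩ t ht]
  simp [abs_of_nonneg hs.1, abs_of_nonneg ht.1]

theorem IsSeg.dist_le {S : Set X} {x y : X} (h : IsSeg S x y) {u v : X} (hu : u ∈ S) (hv : v ∈ S)
    (huv : dist x u ≤ dist x v) : dist u v = dist x v - dist x u := by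
  rw [h.dist_eq hu hv, abs_sub_comm, abs_of_nonneg (by linarith)]

theorem IsSeg.dist_add {S : Set X} {x y : X} (h : IsSeg S x y) {u : X} (hu : u ∈ S) :
    dist x u + dist u y = dist x y := by
  obtain ⟨γ, ℓ, ⟨h0, hd⟩, rfl, rfl, rfl⟩ := h
  obtain ⟨s, hs, rfl⟩ := hu
  rw [hd 0 ⟨le_rfl, h0⟩ s hs, hd s hs ℓ ⟨h0, le_rfl⟩, hd 0 ⟨le_rfl, h0⟩ ℓ ⟨h0, le_rfl⟩]
  rw [abs_of_nonpos (by linarith [hs.1]), abs_of_nonpos (by linarith [hs.2]),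
    abs_of_nonpos (by linarith)]
  ring

theorem IsSeg.dist_le_right {S : Set X} {x y : X} (h : IsSeg S x y) {u : X} (hu : u ∈ S) :
    dist x u ≤ dist x y := by
  have := h.dist_add hu
  have := dist_nonneg (x := u) (y := y)
  linarith

theorem IsSeg.exists_at {S : Set X} {x y : X} (h : IsSeg S x y) {r : ℝ} (h0 : 0 ≤ r)
    (h1 : r ≤ dist x y) : ∃ u ∈ S, dist x u = r := by
  obtain ⟨γ, ℓ, ⟨hl, hd⟩, rfl, rfl, rfl⟩ := h
  rw [hd 0 ⟨le_rfl, hl⟩ ℓ ⟨hl, le_rfl⟩, abs_of_nonpos (by linarith)] at h1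
  have hr : r ∈ Set.Icc 0 ℓ := ⟨h0, by linarith⟩
  refine ⟨γ r, ⟨r, hr, rfl⟩, ?_⟩
  rw [hd 0 ⟨le_rfl, hl⟩ r hr, abs_of_nonpos (by linarith)]; ring

theorem IsSeg.sub {S : Set X} {x y : X} (h : IsSeg S x y) {u v : X} (hu : u ∈ S) (hv : v ∈ S)
    (huv : dist x u ≤ dist x v) :
    IsSeg {s | s ∈ S ∧ dist x u ≤ dist x s ∧ dist x s ≤ dist x v} u v := by
  obtain ⟨γ, ℓ, ⟨h0, hd⟩, rfl, rfl, rfl⟩ := h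
  have key : ∀ t ∈ Set.Icc 0 ℓ, dist (γ 0) (γ t) = t := by
    intro t ht
    rw [hd 0 ⟨le_rfl, h0⟩ t ht, abs_of_nonpos (by linarith [ht.1])]; ring
  obtain ⟨a, ha, rfl⟩ := hu
  obtain ⟨b, hb, rfl⟩ := hv
  rw [key a ha, key b hb] at huv
  refine ⟨fun t => γ (a + t), b - a, ⟨by linarith, ?_⟩, by simp, by simp, ?_⟩
  · intro s hs t ht
    rw [hd _ ⟨by linarith [hs.1, ha.1], by linarith [hs.2, hb.2]⟩ _
      ⟨by linarith [ht.1, ha.1], by linarith [ht.2, hb.2]⟩]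
    congr 1; ring
  · ext p; constructor
    · rintro ⟨⟨t, ht, rfl⟩, h1, h2⟩
      rw [key a ha, key t ht] at h1
      rw [key b hb, key t ht] at h2
      exact ⟨t - a, ⟨by linarith, by linarith⟩, by simp⟩
    · rintro ⟨t, ht, rfl⟩
      have hm : a + t ∈ Set.Icc 0 ℓ := ⟨by linarith [ht.1, ha.1], by linarith [ht.2, hb.2]⟩
      refine ⟨⟨a + t, hm, rfl⟩, ?_⟩
      simp only []
      rw [key a ha, key _ hm, key b hb]
      exact ⟨by linarith [ht.1], by linarith [ht.2]⟩

theorem IsSeg.exists_sub {S : Set X} {x y : X} (h : IsSeg S x y) {u v : X} (hu : u ∈ S)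
    (hv : v ∈ S) : ∃ T, T ⊆ S ∧ IsSeg T u v := by
  rcases le_total (dist x u) (dist x v) with h1 | h1
  · exact ⟨_, fun s hs => hs.1, h.sub hu hv h1⟩
  · exact ⟨_, fun s hs => hs.1, (h.sub hv hu h1).symm⟩

theorem geod_continuousOn {γ : ℝ → X} {ℓ : ℝ} (h : IsGeodesicParam γ ℓ) :
    ContinuousOn γ (Set.Icc 0 ℓ) := by
  have : LipschitzOnWith 1 γ (Set.Icc 0 ℓ) := by
    apply LipschitzOnWith.of_dist_le_mul
    intro s hs t ht
    rw [h.2 s hs t ht, Real.dist_eq]; simp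
  exact this.continuousOn

theorem IsSeg.isCompact {S : Set X} {x y : X} (h : IsSeg S x y) : IsCompact S := by
  obtain ⟨γ, ℓ, hg, rfl, rfl, rfl⟩ := h
  exact isCompact_Icc.image_of_continuousOn (geod_continuousOn hg)

theorem IsSeg.exists_near {S : Set X} {x y : X} (h : IsSeg S x y) (p : X) :
    ∃ s ∈ S, infDist p S = dist p s :=
  h.isCompact.exists_infDist_eq_dist ⟨x, h.left_mem⟩ p

theorem IsSeg.crossing {S : Set X} {x y : X} (h : IsSeg S x y) {f : X → ℝ} (hf : Continuous f)
    {u v : X} (hu : u ∈ S) (hv : v ∈ S) (huv : dist x u ≤ dist x v) {r : ℝ} (hfu : f u ≤ r)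
    (hfv : r ≤ f v) :
    ∃ w ∈ S, dist x u ≤ dist x w ∧ dist x w ≤ dist x v ∧ f w = r ∧
      ∀ s ∈ S, dist x w ≤ dist x s → dist x s ≤ dist x v → r ≤ f s := by
  have hS := h.sub hu hv huv
  set T := {s | s ∈ S ∧ dist x u ≤ dist x s ∧ dist x s ≤ dist x v} with hT
  have hK : IsCompact {s | s ∈ T ∧ f s ≤ r} :=
    hS.isCompact.inter_right (isClosed_le hf continuous_const)
  obtain ⟨w, ⟨hwT, hwr⟩, hmax⟩ := hK.exists_isMaxOn ⟨u, hS.left_mem, hfu⟩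
    (f := fun s => dist x s) (by fun_prop)
  have hmax' : ∀ s ∈ T, f s ≤ r → dist x s ≤ dist x w := fun s hs hs' => hmax ⟨hs, hs'⟩
  have hpos : ∀ s ∈ S, dist x w < dist x s → dist x s ≤ dist x v → r < f s := by
    intro s hs h1 h2
    by_contra hc
    have := hmax' s ⟨hs, by linarith [hwT.2.1], h2⟩ (not_lt.1 hc)
    linarith
  have hwr' : f w = r := by
    refine le_antisymm hwr ?_
    by_contra hc
    push Not at hc
    have hsub := h.sub hwT.1 hv hwT.2.2
    have hconn : IsPreconnected {s | s ∈ S ∧ dist x w ≤ dist x s ∧ dist x s ≤ dist x v} := by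
      obtain ⟨γ, ℓ, hg, _, _, he⟩ := hsub
      rw [he]
      exact isPreconnected_Icc.image _ (geod_continuousOn hg)
    obtain ⟨s, hs, hsr⟩ := hconn.intermediate_value hsub.left_mem hsub.right_mem
      hf.continuousOn (show (f w + r) / 2 ∈ Set.Icc (f w) (f v) from ⟨by linarith, by linarith⟩)
    rcases eq_or_lt_of_le hs.2.1 with h1 | h1
    · have : dist w s = 0 := by rw [h.dist_le hwT.1 hs.1 hs.2.1]; linarith
      rw [dist_eq_zero] at this
      subst this
      linarith
    · have := hpos s hs.1 h1 hs.2.2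
      linarith
  refine ⟨w, hwT.1, hwT.2.1, hwT.2.2, hwr', ?_⟩
  intro s hs h1 h2
  rcases eq_or_lt_of_le h1 with h3 | h3
  · have : dist w s = 0 := by rw [h.dist_le hwT.1 hs h1]; linarith
    rw [dist_eq_zero] at this
    subst this
    exact hwr'.ge
  · exact (hpos s hs h3 h2).le

theorem IsSeg.crossing' {S : Set X} {x y : X} (h : IsSeg S x y) {f : X → ℝ} (hf : Continuous f)
    {u v : X} (hu : u ∈ S) (hv : v ∈ S) (huv : dist x u ≤ dist x v) {r : ℝ} (hfu : r ≤ f u)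
    (hfv : f v ≤ r) :
    ∃ w ∈ S, dist x u ≤ dist x w ∧ dist x w ≤ dist x v ∧ f w = r ∧
      ∀ s ∈ S, dist x u ≤ dist x s → dist x s ≤ dist x w → r ≤ f s := by
  have e : ∀ s ∈ S, dist y s = dist x y - dist x s := by
    intro s hs
    have := h.dist_add hs
    rw [dist_comm y s]; linarith
  obtain ⟨w, hw, h1, h2, h3, h4⟩ := h.symm.crossing hf hv hu (by rw [e u hu, e v hv]; linarith) hfv hfu
  rw [e v hv, e w hw] at h1
  rw [e u hu, e w hw] at h2
  refine ⟨w, hw, by linarith, by linarith, h3, ?_⟩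
  intro s hs h5 h6
  exact h4 s hs (by rw [e s hs, e w hw]; linarith) (by rw [e s hs, e u hu]; linarith)

theorem GeodesicSpace.exists_seg (hX : GeodesicSpace X) (x y : X) : ∃ S, IsSeg S x y := by
  obtain ⟨γ, ℓ, h, h0, h1⟩ := hX x y
  exact ⟨_, γ, ℓ, h, h0, h1, rfl⟩

/-! ### Fat hexagons -/

theorem corner_aux {S T : Set X} {v b : X} (hT : IsSeg T v b) {θ : ℝ}
    (hc : ∀ s ∈ S, dist b v ≤ dist b s) {s q : X} (hs : s ∈ S) (hq : q ∈ T)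
    (hsq : dist s q < θ) : dist s v < 2 * θ ∧ dist q v < 2 * θ := by
  have h1 := hc s hs
  have h2 := hT.dist_add hq
  have h3 := dist_triangle b q s
  have h4 := dist_triangle s q v
  rw [dist_comm b v, dist_comm b q] at *
  rw [dist_comm q s] at h3
  rw [dist_comm v q] at h2
  have h5 := dist_nonneg (x := s) (y := q)
  constructor <;> linarith

/-- Corner condition between consecutive segments `S = [a,v]`, `T = [v,b]`. -/
def Corner (S T : Set X) (a v b : X) : Prop :=
  (∀ s ∈ S, dist b v ≤ dist b s) ∨ (∀ s ∈ T, dist a v ≤ dist a s)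

theorem corner_spec {S T : Set X} {a v b : X} (hS : IsSeg S a v) (hT : IsSeg T v b)
    (hc : Corner S T a v b) {θ : ℝ} {s q : X} (hs : s ∈ S) (hq : q ∈ T)
    (hsq : dist s q < θ) : dist s v < 2 * θ ∧ dist q v < 2 * θ := by
  rcases hc with hc | hc
  · exact corner_aux hT hc hs hq hsq
  · have := corner_aux hS.symm hc hq hs (by rwa [dist_comm])
    exact ⟨this.2, this.1⟩

/-- Two sets are at distance at least `r`. -/
def FarS (r : ℝ) (S T : Set X) : Prop := ∀ s ∈ S, ∀ t ∈ T, r ≤ dist s t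

theorem FarS.symm {r : ℝ} {S T : Set X} (h : FarS r S T) : FarS r T S := by
  intro s hs t ht
  rw [dist_comm]
  exact h t ht s hs


theorem hexagon_fin {𝓐 : Set (Set X)} {η θ ν χ : ℝ} (hθ : 0 < θ) (hν : 8 ≤ ν)
    (h3 : Beta3EtaWith 𝓐 η θ ν χ) (v : Fin 6 → X) (S : Fin 6 → Set X)
    (hS : ∀ i, IsSeg (S i) (v i) (v (finCycSucc i)))
    (hfar : ∀ i j, j ≠ i → j ≠ finCycSucc i → i ≠ finCycSucc j → FarS (ν * θ) (S i) (S j))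
    (hcor : ∀ i, Corner (S i) (S (finCycSucc i)) (v i) (v (finCycSucc i))
      (v (finCycSucc (finCycSucc i))))
    (hη : η ≤ dist (v 0) (v 1)) :
    ∃ A ∈ 𝓐, ∀ i, ∀ s ∈ S i, infDist s A < χ := by
  choose e l hg hl hr hE using hS
  have hνθ : θ ≤ ν * θ := by nlinarith
  let P : PrePolygon X 6 := ⟨e, l⟩
  have hset : ∀ i, P.edgeSet i = S i := fun i => (hE i).symm
  have hcar : P.carrier = ⋃ i, S i := by simp [PrePolygon.carrier, hset]
  have hS : ∀ i, IsSeg (S i) (v i) (v (finCycSucc i)) :=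
    fun i => ⟨e i, l i, hg i, hl i, hr i, hE i⟩
  have hP : P.IsGeodesicPolygon := by
    refine ⟨⟨fun i => (hg i).1, fun i => ?_⟩, hg⟩
    change e i (l i) = e (finCycSucc i) 0
    rw [hr, hl]
  have hnon : ∀ i : Fin 6, ∃ j, j ≠ i ∧ j ≠ finCycSucc i ∧ i ≠ finCycSucc j := by decide
  have hopp : ∀ i j : Fin 6, j ≠ i → finCycSucc j ≠ i →
      (j ≠ i ∧ j ≠ finCycSucc i ∧ i ≠ finCycSucc j) ∨
      (∃ m, finCycSucc m = i ∧ (j ≠ m ∧ j ≠ finCycSucc m ∧ m ≠ finCycSucc j)) := by decide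
  have hfat : P.IsFat2 θ ν := by
    constructor
    · intro i p hp h0 h1
      rw [hset] at hp
      change 2 * θ ≤ dist p (e i 0) at h0
      change 2 * θ ≤ dist p (e i (l i)) at h1
      rw [hl] at h0
      rw [hr] at h1
      rw [hset, hcar]
      have hne : ((⋃ i, S i) \ S i).Nonempty := by
        obtain ⟨j, hj1, hj2, hj3⟩ := hnon i
        refine ⟨v j, mem_iUnion.2 ⟨j, (hS j).left_mem⟩, fun hc => ?_⟩
        have := hfar i j hj1 hj2 hj3 _ hc _ (hS j).left_mem
        rw [dist_self] at this
        linarith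
      rw [le_infDist hne]
      rintro q ⟨hq, hqi⟩
      obtain ⟨j, hq⟩ := mem_iUnion.1 hq
      by_contra hlt
      push Not at hlt
      by_cases hj1 : j = i
      · subst hj1; exact hqi hq
      by_cases hj2 : j = finCycSucc i
      · subst hj2
        have := corner_spec (hS i) (hS _) (hcor i) hp hq hlt
        linarith [this.1]
      by_cases hj3 : i = finCycSucc j
      · subst hj3
        have := corner_spec (hS j) (hS _) (hcor j) hq hp (by rwa [dist_comm])
        linarith [this.2]
      have := hfar i j hj1 hj2 hj3 _ hp _ hq
      linarith
    · intro i
      have hv : P.vertex i = v i := hl i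
      have hne : (P.opp i).Nonempty := by
        obtain ⟨j, hj1, hj2, hj3⟩ := hnon i
        refine ⟨v j, mem_iUnion₂.2 ⟨j, ⟨hj1, hj3.symm⟩, ?_⟩⟩
        rw [hset]; exact (hS j).left_mem
      rw [hv, le_infDist hne]
      intro q hq
      obtain ⟨j, ⟨hj1, hj2⟩, hq⟩ := mem_iUnion₂.1 hq
      rw [hset] at hq
      rcases hopp i j hj1 hj2 with ⟨h1, h2, h4⟩ | ⟨m, hm, h1, h2, h4⟩
      · exact hfar i j h1 h2 h4 _ (hS i).left_mem _ hq
      · have := (hS m).right_mem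
        rw [hm] at this
        exact hfar m j h1 h2 h4 _ this _ hq
  have hcomp : IsCompact P.carrier := by
    rw [hcar]; exact isCompact_iUnion fun i => (hS i).isCompact
  have hdiam : η ≤ Metric.diam P.carrier := by
    refine hη.trans (dist_le_diam_of_mem hcomp.isBounded ?_ ?_)
    · rw [hcar]; exact mem_iUnion.2 ⟨0, (hS 0).left_mem⟩
    · rw [hcar]; exact mem_iUnion.2 ⟨1, (hS 1).left_mem⟩
  obtain ⟨A, hA, hsub⟩ := h3 P hP hfat hdiam
  refine ⟨A, hA, fun i s hs => hsub ?_⟩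
  rw [hcar]; exact mem_iUnion.2 ⟨i, hs⟩

theorem hexagon {𝓐 : Set (Set X)} {η θ ν χ : ℝ} (hθ : 0 < θ) (hν : 8 ≤ ν)
    (h3 : Beta3EtaWith 𝓐 η θ ν χ) {v0 v1 v2 v3 v4 v5 : X} {S0 S1 S2 S3 S4 S5 : Set X}
    (s0 : IsSeg S0 v0 v1) (s1 : IsSeg S1 v1 v2) (s2 : IsSeg S2 v2 v3) (s3 : IsSeg S3 v3 v4)
    (s4 : IsSeg S4 v4 v5) (s5 : IsSeg S5 v5 v0)
    (f02 : FarS (ν * θ) S0 S2) (f03 : FarS (ν * θ) S0 S3) (f04 : FarS (ν * θ) S0 S4)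
    (f13 : FarS (ν * θ) S1 S3) (f14 : FarS (ν * θ) S1 S4) (f15 : FarS (ν * θ) S1 S5)
    (f24 : FarS (ν * θ) S2 S4) (f25 : FarS (ν * θ) S2 S5) (f35 : FarS (ν * θ) S3 S5)
    (c0 : Corner S0 S1 v0 v1 v2) (c1 : Corner S1 S2 v1 v2 v3) (c2 : Corner S2 S3 v2 v3 v4)
    (c3 : Corner S3 S4 v3 v4 v5) (c4 : Corner S4 S5 v4 v5 v0) (c5 : Corner S5 S0 v5 v0 v1)
    (hη : η ≤ dist v0 v1) :
    ∃ A ∈ 𝓐, ∀ s, s ∈ S0 ∨ s ∈ S1 ∨ s ∈ S2 ∨ s ∈ S3 ∨ s ∈ S4 ∨ s ∈ S5 → infDist s A < χ := by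
  obtain ⟨A, hA, h⟩ := hexagon_fin hθ hν h3 ![v0, v1, v2, v3, v4, v5] ![S0, S1, S2, S3, S4, S5]
    (by intro i; fin_cases i <;> assumption)
    (by
      intro i j h1 h2 h4
      fin_cases i <;> fin_cases j <;>
        first
          | exact absurd rfl h1
          | exact absurd rfl h2
          | exact absurd rfl h4
          | assumption
          | (apply FarS.symm; assumption))
    (by intro i; fin_cases i <;> assumption)
    hη
  refine ⟨A, hA, ?_⟩
  rintro s (h1 | h1 | h1 | h1 | h1 | h1)
  · exact h 0 s h1
  · exact h 1 s h1
  · exact h 2 s h1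
  · exact h 3 s h1
  · exact h 4 s h1
  · exact h 5 s h1

theorem tri4 (a b c d : X) : dist a d ≤ dist a b + dist b c + dist c d := dist_triangle4 a b c d

theorem bigon (hX : GeodesicSpace X) {𝓐 : Set (Set X)} {η θ ν χ r : ℝ} (hθ : 0 < θ) (hν : 8 ≤ ν)
    (h3 : Beta3EtaWith 𝓐 η θ ν χ) (hr0 : 0 < r) (hr1 : ν * θ ≤ r) (hr2 : η ≤ r)
    {S G : Set X} {a b a' b' : X} (hS : IsSeg S a b) (hG : IsSeg G a' b')
    (ha : dist a a' = r) (hb : dist b b' = r) (hfar : FarS r S G) (hab : 20 * r ≤ dist a b) :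
    ∃ A ∈ 𝓐, ∀ s ∈ S, infDist s A < χ := by
  have hab' : 18 * r ≤ dist b' a' := by
    have := dist_triangle4 a a' b' b
    rw [dist_comm b' b, hb, ha, dist_comm a' b'] at this
    linarith
  obtain ⟨m1, hm1, d1⟩ := hG.symm.exists_at (r := 6 * r) (by linarith) (by linarith)
  obtain ⟨m2, hm2, d2⟩ := hG.symm.exists_at (r := 12 * r) (by linarith) (by linarith)
  obtain ⟨S1, hS1⟩ := hX.exists_seg b b'
  obtain ⟨S5, hS5⟩ := hX.exists_seg a' a
  have g2 := hG.symm.sub hG.symm.left_mem hm1 (by simp)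
  have g3 := hG.symm.sub hm1 hm2 (by linarith)
  have g4 := hG.symm.sub hm2 hG.symm.right_mem (by linarith)
  obtain ⟨A, hA, h⟩ := hexagon hθ hν h3 hS hS1 g2 g3 g4 hS5
    (fun s hs t ht => hr1.trans (hfar s hs t ht.1))
    (fun s hs t ht => hr1.trans (hfar s hs t ht.1))
    (fun s hs t ht => hr1.trans (hfar s hs t ht.1))
    (by
      intro s hs t ht
      have h1 := hS1.dist_add hs
      have h2 := ht.2.1
      have h4 := dist_triangle b' s t
      rw [dist_comm b' s] at h4
      have := dist_nonneg (x := b) (y := s)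
      linarith)
    (by
      intro s hs t ht
      have h1 := hS1.dist_add hs
      have h2 := ht.2.1
      have h4 := dist_triangle b' s t
      rw [dist_comm b' s] at h4
      have := dist_nonneg (x := b) (y := s)
      linarith)
    (by
      intro s hs t ht
      have h1 := hS1.dist_add hs
      have h2 := hS5.dist_add ht
      have h4 := dist_triangle4 b s t a
      rw [dist_comm b a] at h4
      rw [dist_comm a' a] at h2
      have := dist_nonneg (x := s) (y := b')
      have := dist_nonneg (x := a') (y := t)
      linarith)
    (by
      intro s hs t ht
      have h1 := hs.2.2
      have h2 := ht.2.1
      have h4 := dist_triangle b' s t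
      linarith)
    (by
      intro s hs t ht
      have h1 := hs.2.2
      have h2 := hS5.dist_add ht
      have h4 := dist_triangle4 b' s t a'
      rw [dist_comm t a'] at h4
      rw [dist_comm a' a] at h2
      have := dist_nonneg (x := t) (y := a)
      linarith)
    (by
      intro s hs t ht
      have h1 := hs.2.2
      have h2 := hS5.dist_add ht
      have h4 := dist_triangle4 b' s t a'
      rw [dist_comm t a'] at h4
      rw [dist_comm a' a] at h2
      have := dist_nonneg (x := t) (y := a)
      linarith)
    (Or.inl fun s hs => by
      rw [dist_comm b' b, hb, dist_comm]; exact hfar s hs _ hG.right_mem)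
    (Or.inr fun s hs => by rw [hb]; exact hfar _ hS.right_mem s hs.1)
    (Or.inl fun s hs => by
      rw [dist_comm m2 m1, dist_comm m2 s, hG.symm.dist_le hm1 hm2 (by linarith),
        hG.symm.dist_le hs.1 hm2 (by linarith [hs.2.2])]
      linarith [hs.2.2])
    (Or.inl fun s hs => by
      rw [dist_comm a' m2, dist_comm a' s, hG.symm.dist_le hm2 hG.left_mem (by linarith),
        hG.symm.dist_le hs.1 hG.left_mem (by linarith [hs.2.2])]
      linarith [hs.2.2])
    (Or.inl fun s hs => by rw [ha]; exact hfar _ hS.left_mem s hs.1)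
    (Or.inr fun s hs => by
      rw [dist_comm a' a, ha, dist_comm]; exact hfar s hs _ hG.left_mem)
    (by linarith)
  exact ⟨A, hA, fun s hs => h s (Or.inl hs)⟩

/-- A point of a short cut `[c,d]` stays far from a set far from both endpoints. -/
theorem cut_far {T E : Set X} {c c' : X} (hT : IsSeg T c c') {r : ℝ} (hc : dist c c' ≤ r)
    (h1 : ∀ e ∈ E, r ≤ dist c e) (h2 : ∀ e ∈ E, r ≤ dist c' e) : FarS (r / 2) T E := by
  intro t ht e he
  have h3 := hT.dist_add ht
  have h4 := dist_triangle c t e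
  have h5 := dist_triangle c' t e
  rw [dist_comm c' t] at h5
  have := h1 e he
  have := h2 e he
  linarith

theorem cut_cut {T T' : Set X} {c c' d d' : X} (hT : IsSeg T c c') (hT' : IsSeg T' d d') {r : ℝ}
    (hc : dist c c' ≤ r) (hd : dist d d' ≤ r) (h : 3 * r ≤ dist c d) : FarS r T T' := by
  intro t ht e he
  have h3 := hT.dist_add ht
  have h4 := hT'.dist_add he
  have h5 := dist_triangle4 c t e d
  rw [dist_comm e d] at h5
  have := dist_nonneg (x := t) (y := c')
  have := dist_nonneg (x := e) (y := d')
  linarith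

theorem FarS.mono {r r' : ℝ} {S T : Set X} (h : FarS r S T) (hr : r' ≤ r) : FarS r' S T :=
  fun s hs t ht => hr.trans (h s hs t ht)

theorem triangle_cut (hX : GeodesicSpace X) {𝓐 : Set (Set X)} {η θ ν χ r : ℝ} (hθ : 0 < θ)
    (hν : 8 ≤ ν) (h3 : Beta3EtaWith 𝓐 η θ ν χ) (hr0 : 0 < r) (hr1 : 2 * (ν * θ) ≤ r) (hr2 : η ≤ r)
    {S G1 G2 : Set X} {a b a' b' z : X} (hS : IsSeg S a b) (hG1 : IsSeg G1 z a')
    (hG2 : IsSeg G2 z b')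
    (ha : dist a a' = r) (hb : dist b b' = r) (hf1 : FarS r S G1) (hf2 : FarS r S G2)
    (hab : 3 * r ≤ dist a b) :
    infDist a G2 ≤ 5 * r ∨ infDist b G1 ≤ 5 * r ∨
    ∃ A ∈ 𝓐, (∀ s ∈ S, infDist s A < χ) ∧ ∃ c ∈ G1, ∃ c' ∈ G2, dist c c' ≤ r ∧ infDist c A < χ := by
  by_cases hA : infDist a G2 ≤ 5 * r
  · exact Or.inl hA
  by_cases hB : infDist b G1 ≤ 5 * r
  · exact Or.inr (Or.inl hB)
  right; right
  push Not at hA hB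
  have ha2 : r ≤ infDist a' G2 := by
    have := infDist_le_infDist_add_dist (s := G2) (x := a) (y := a')
    linarith
  obtain ⟨c, hcG, -, -, hcr, hcmax⟩ := hG1.crossing (continuous_infDist_pt G2) hG1.left_mem
    hG1.right_mem (by simp) (r := r) (by rw [infDist_zero_of_mem hG2.left_mem]; exact hr0.le) ha2
  obtain ⟨c', hcG', hcc⟩ := hG2.exists_near c
  rw [hcr] at hcc
  have hE4 := hG1.sub hcG hG1.right_mem (hG1.dist_le_right hcG)
  obtain ⟨E2, hE2G, hE2⟩ := hG2.exists_sub hG2.right_mem hcG'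
  obtain ⟨S1, hS1⟩ := hX.exists_seg b b'
  obtain ⟨S3, hS3⟩ := hX.exists_seg c' c
  obtain ⟨S5, hS5⟩ := hX.exists_seg a' a
  have f24 : FarS r E2 {s | s ∈ G1 ∧ dist z c ≤ dist z s ∧ dist z s ≤ dist z a'} := by
    intro s hs t ht
    rw [dist_comm]
    exact (hcmax t ht.1 ht.2.1 ht.2.2).trans (infDist_le_dist_of_mem (hE2G hs))
  have hca : 3 * r ≤ dist a' c := by
    have h1 := infDist_le_dist_of_mem (x := a) hcG'
    have h2 := dist_triangle4 a a' c c'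
    linarith
  have hcb : 3 * r ≤ dist b' c' := by
    have h1 := infDist_le_dist_of_mem (x := b) hcG
    have h2 := dist_triangle4 b b' c' c
    rw [dist_comm c' c] at h2
    linarith
  have hr1' : ν * θ ≤ r := by linarith
  have hr1'' : ν * θ ≤ r / 2 := by linarith
  obtain ⟨A, hA, h⟩ := hexagon hθ hν h3 hS hS1 hE2 hS3 hE4 hS5
    (fun s hs t ht => hr1'.trans (hf2 s hs t (hE2G ht)))
    ((cut_far hS3 (by rw [dist_comm, ← hcc]) (fun e he => by
        rw [dist_comm]; exact hf2 e he _ hcG')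
      (fun e he => by rw [dist_comm]; exact hf1 e he _ hcG)).symm.mono hr1'')
    (fun s hs t ht => hr1'.trans (hf1 s hs t ht.1))
    ((cut_cut hS1.symm hS3 (by rw [dist_comm, hb]) (by rw [dist_comm, ← hcc]) hcb).mono hr1')
    ((cut_far hS1 hb.le (fun e he => hf1 _ hS.right_mem _ he.1)
      (fun e he => f24 _ hE2.left_mem _ he)).mono hr1'')
    ((cut_cut hS1 hS5.symm hb.le ha.le (by rwa [dist_comm])).mono hr1')
    (f24.mono hr1')
    ((cut_far hS5 (by rw [dist_comm, ha]) (fun e he => by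
        rw [dist_comm]; exact f24 e he _ hE4.right_mem)
      (fun e he => hf2 _ hS.left_mem _ (hE2G he))).symm.mono hr1'')
    ((cut_cut hS3.symm hS5 hcc.ge (by rw [dist_comm, ha]) (by rwa [dist_comm])).mono hr1')
    (Or.inl fun s hs => by
      rw [dist_comm b' b, hb, dist_comm]; exact hf2 s hs _ hG2.right_mem)
    (Or.inr fun s hs => by rw [hb]; exact hf2 _ hS.right_mem s (hE2G hs))
    (Or.inl fun s hs => by
      rw [← hcc, dist_comm]; exact f24 s hs _ hE4.left_mem)
    (Or.inr fun s hs => by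
      rw [dist_comm c' c, ← hcc]; exact f24 _ hE2.right_mem _ hs)
    (Or.inl fun s hs => by rw [ha]; exact hf1 _ hS.left_mem s hs.1)
    (Or.inr fun s hs => by
      rw [dist_comm a' a, ha, dist_comm]; exact hf1 s hs _ hG1.right_mem)
    (by linarith)
  exact ⟨A, hA, fun s hs => h s (Or.inl hs), c, hcG, c', hcG', hcc.ge,
    (h c (by right; right; right; left; exact hS3.right_mem))⟩

/-- `p` is within `R` of the set `S`. -/
def Near (R : ℝ) (p : X) (S : Set X) : Prop := ∃ s ∈ S, dist p s ≤ R

theorem Near.mono {R R' : ℝ} {p : X} {S : Set X} (h : Near R p S) (hR : R ≤ R') : Near R' p S := by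
  obtain ⟨s, hs, hd⟩ := h
  exact ⟨s, hs, hd.trans hR⟩

theorem Near.of_dist {R R' : ℝ} {p q : X} {S : Set X} (h : Near R p S) (hR : dist q p + R ≤ R') :
    Near R' q S := by
  obtain ⟨s, hs, hd⟩ := h
  exact ⟨s, hs, by linarith [dist_triangle q p s]⟩

/-- the relative thinness property of triangles -/
def Thin (𝓐 : Set (Set X)) (R : ℝ) : Prop :=
  ∀ (x y z : X) (S G1 G2 : Set X), IsSeg S x y → IsSeg G1 z x → IsSeg G2 z y → ∀ p ∈ S,
    Near R p G1 ∨ Near R p G2 ∨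
    ∃ A ∈ 𝓐, ∃ u ∈ S, ∃ v ∈ S, dist x u ≤ dist x p ∧ dist x p ≤ dist x v ∧
      (∀ s ∈ S, dist x u ≤ dist x s → dist x s ≤ dist x v → infDist s A ≤ R) ∧
      ((Near R u G1 ∧ Near R v G1) ∨ (Near R u G2 ∧ Near R v G2) ∨
       (((Near R u G1 ∧ Near R v G2) ∨ (Near R u G2 ∧ Near R v G1)) ∧
        ∃ c ∈ G1, ∃ c' ∈ G2, dist c c' ≤ R ∧ infDist c A ≤ R))

theorem near_of_infDist {S : Set X} {x y p : X} {R : ℝ} (hS : IsSeg S x y) (h : infDist p S ≤ R) :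
    Near R p S := by
  obtain ⟨s, hs, he⟩ := hS.exists_near p
  exact ⟨s, hs, by rw [← he]; exact h⟩

theorem bigon_cross (hX : GeodesicSpace X) {𝓐 : Set (Set X)} {η θ ν χ r : ℝ} (hθ : 0 < θ)
    (hν : 8 ≤ ν) (h3 : Beta3EtaWith 𝓐 η θ ν χ) (hr0 : 0 < r) (hr1 : ν * θ ≤ r) (hr2 : η ≤ r)
    {S G : Set X} {x y g g' a p b : X} (hS : IsSeg S x y) (hG : IsSeg G g g')
    (ha : a ∈ S) (hp : p ∈ S) (hb : b ∈ S) (hap : dist x a ≤ dist x p) (hpb : dist x p ≤ dist x b)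
    (hfa : infDist a G ≤ r) (hfb : infDist b G ≤ r) (hfp : 30 * r ≤ infDist p G) :
    ∃ A ∈ 𝓐, ∃ u ∈ S, ∃ v ∈ S, dist x u ≤ dist x p ∧ dist x p ≤ dist x v ∧
      (∀ s ∈ S, dist x u ≤ dist x s → dist x s ≤ dist x v → infDist s A ≤ χ) ∧
      Near r u G ∧ Near r v G := by
  obtain ⟨u, hu, -, hup, hur, humax⟩ := hS.crossing (continuous_infDist_pt G) ha hp hap hfa
    (show r ≤ _ by linarith)
  obtain ⟨v, hv, hpv, -, hvr, hvmax⟩ := hS.crossing' (continuous_infDist_pt G) hp hb hpb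
    (show r ≤ _ by linarith) hfb
  obtain ⟨u', hu', hud⟩ := hG.exists_near u
  obtain ⟨v', hv', hvd⟩ := hG.exists_near v
  obtain ⟨H, hHG, hH⟩ := hG.exists_sub hu' hv'
  have hsub := hS.sub hu hv (hup.trans hpv)
  have hfar : FarS r {s | s ∈ S ∧ dist x u ≤ dist x s ∧ dist x s ≤ dist x v} H := by
    rintro s ⟨hs, h1, h2⟩ t ht
    refine le_trans ?_ (infDist_le_dist_of_mem (hHG ht))
    rcases le_total (dist x s) (dist x p) with h4 | h4
    · exact humax s hs h1 h4
    · exact hvmax s hs h4 h2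
  have huv : 20 * r ≤ dist u v := by
    have h1 := infDist_le_infDist_add_dist (s := G) (x := p) (y := u)
    rw [dist_comm p u, hS.dist_le hu hp hup] at h1
    rw [hS.dist_le hu hv (hup.trans hpv)]
    linarith
  obtain ⟨A, hA, h⟩ := bigon hX hθ hν h3 hr0 hr1 hr2 hsub hH (by rw [← hud, hur])
    (by rw [← hvd, hvr]) hfar huv
  exact ⟨A, hA, u, hu, v, hv, hup, hpv, fun s hs h1 h2 => (h s ⟨hs, h1, h2⟩).le,
    ⟨u', hu', by rw [← hud, hur]⟩, ⟨v', hv', by rw [← hvd, hvr]⟩⟩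

theorem thin_of_beta3 (hX : GeodesicSpace X) {𝓐 : Set (Set X)} {η : ℝ}
    (h3 : Beta3Eta 𝓐 η) : ∃ R, 0 < R ∧ Thin 𝓐 R := by
  obtain ⟨θ, hθ, ν, hν, χ, hχ, h3⟩ := h3
  obtain ⟨r, hr⟩ : ∃ r, r = max (2 * (ν * θ)) η := ⟨_, rfl⟩
  have hνθ : 0 < ν * θ := by positivity
  have hr1 : 2 * (ν * θ) ≤ r := hr ▸ le_max_left _ _
  have hr2 : η ≤ r := hr ▸ le_max_right _ _
  have hr0 : 0 < r := by linarith
  refine ⟨150 * r + χ, by linarith, ?_⟩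
  intro x y z S G1 G2 hS hG1 hG2 p hp
  by_cases hp1 : infDist p G1 ≤ 150 * r
  · exact Or.inl ((near_of_infDist hG1 hp1).mono (by linarith))
  by_cases hp2 : infDist p G2 ≤ 150 * r
  · exact Or.inr (Or.inl ((near_of_infDist hG2 hp2).mono (by linarith)))
  right; right
  push Not at hp1 hp2
  have big1 : ∀ a ∈ S, ∀ b ∈ S, dist x a ≤ dist x p → dist x p ≤ dist x b →
      infDist a G1 ≤ 5 * r → infDist b G1 ≤ 5 * r →
      ∃ A ∈ 𝓐, ∃ u ∈ S, ∃ v ∈ S, dist x u ≤ dist x p ∧ dist x p ≤ dist x v ∧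
      (∀ s ∈ S, dist x u ≤ dist x s → dist x s ≤ dist x v → infDist s A ≤ 150 * r + χ) ∧
      Near (150 * r + χ) u G1 ∧ Near (150 * r + χ) v G1 := by
    intro a ha b hb h1 h2 h4 h5
    obtain ⟨A, hA, u, hu, v, hv, e1, e2, e3, e4, e5⟩ := bigon_cross hX hθ hν h3 (r := 5 * r)
      (by linarith) (by linarith) (by linarith) hS hG1 ha hp hb h1 h2 h4 h5 (by linarith)
    exact ⟨A, hA, u, hu, v, hv, e1, e2, fun s hs h6 h7 => by linarith [e3 s hs h6 h7],
      e4.mono (by linarith), e5.mono (by linarith)⟩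
  have big2 : ∀ a ∈ S, ∀ b ∈ S, dist x a ≤ dist x p → dist x p ≤ dist x b →
      infDist a G2 ≤ 5 * r → infDist b G2 ≤ 5 * r →
      ∃ A ∈ 𝓐, ∃ u ∈ S, ∃ v ∈ S, dist x u ≤ dist x p ∧ dist x p ≤ dist x v ∧
      (∀ s ∈ S, dist x u ≤ dist x s → dist x s ≤ dist x v → infDist s A ≤ 150 * r + χ) ∧
      Near (150 * r + χ) u G2 ∧ Near (150 * r + χ) v G2 := by
    intro a ha b hb h1 h2 h4 h5
    obtain ⟨A, hA, u, hu, v, hv, e1, e2, e3, e4, e5⟩ := bigon_cross hX hθ hν h3 (r := 5 * r)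
      (by linarith) (by linarith) (by linarith) hS hG2 ha hp hb h1 h2 h4 h5 (by linarith)
    exact ⟨A, hA, u, hu, v, hv, e1, e2, fun s hs h6 h7 => by linarith [e3 s hs h6 h7],
      e4.mono (by linarith), e5.mono (by linarith)⟩
  -- crossings for the distance to the union
  have hcont : Continuous fun s => min (infDist s G1) (infDist s G2) :=
    (continuous_infDist_pt G1).min (continuous_infDist_pt G2)
  obtain ⟨a, ha, -, hap, har, hamax⟩ := hS.crossing hcont hS.left_mem hp (by simp) (r := r)
    (min_le_of_left_le (by rw [infDist_zero_of_mem hG1.right_mem]; exact hr0.le))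
    (le_min (by linarith) (by linarith))
  obtain ⟨b, hb, hpb, -, hbr, hbmax⟩ := hS.crossing' hcont hp hS.right_mem (hS.dist_le_right hp)
    (r := r) (le_min (by linarith) (by linarith))
    (min_le_of_right_le (by rw [infDist_zero_of_mem hG2.right_mem]; exact hr0.le))
  have hall : ∀ s ∈ S, dist x a ≤ dist x s → dist x s ≤ dist x b →
      r ≤ infDist s G1 ∧ r ≤ infDist s G2 := by
    intro s hs h1 h2
    rw [← le_min_iff]
    rcases le_total (dist x s) (dist x p) with h4 | h4
    · exact hamax s hs h1 h4
    · exact hbmax s hs h4 h2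
  have hsub := hS.sub ha hb (hap.trans hpb)
  have hab : ∀ w, infDist a w ≤ r → 150 * r < infDist p w → 3 * r ≤ dist a b := by
    intro w h1 h2
    have h4 := infDist_le_infDist_add_dist (s := w) (x := p) (y := a)
    rw [dist_comm p a, hS.dist_le ha hp hap] at h4
    rw [hS.dist_le ha hb (hap.trans hpb)]
    linarith
  have hf1 : ∀ H ⊆ G1, FarS r {s | s ∈ S ∧ dist x a ≤ dist x s ∧ dist x s ≤ dist x b} H :=
    fun H hH s hs t ht => (hall s hs.1 hs.2.1 hs.2.2).1.trans (infDist_le_dist_of_mem (hH ht))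
  have hf2 : ∀ H ⊆ G2, FarS r {s | s ∈ S ∧ dist x a ≤ dist x s ∧ dist x s ≤ dist x b} H :=
    fun H hH s hs t ht => (hall s hs.1 hs.2.1 hs.2.2).2.trans (infDist_le_dist_of_mem (hH ht))
  have hmono : ∀ (w : X) (H K : Set X), H ⊆ K → z ∈ H → infDist w K ≤ infDist w H :=
    fun w H K h1 h2 => infDist_le_infDist_of_subset h1 ⟨z, h2⟩
  rcases min_choice (infDist a G1) (infDist a G2) with ea | ea <;>
  rcases min_choice (infDist b G1) (infDist b G2) with eb | eb <;>
  rw [har] at ea <;> rw [hbr] at eb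
  · obtain ⟨A, hA, u, hu, v, hv, e1, e2, e3, e4⟩ := big1 a ha b hb hap hpb (by linarith) (by linarith)
    exact ⟨A, hA, u, hu, v, hv, e1, e2, e3, Or.inl e4⟩
  · obtain ⟨a', ha', hda⟩ := hG1.exists_near a
    obtain ⟨b', hb', hdb⟩ := hG2.exists_near b
    have k1 := hG1.sub hG1.left_mem ha' (by simp)
    have k2 := hG2.sub hG2.left_mem hb' (by simp)
    rcases triangle_cut hX hθ hν h3 hr0 hr1 hr2 hsub k1 k2 (by linarith) (by linarith)
      (hf1 _ fun s hs => hs.1) (hf2 _ fun s hs => hs.1) (hab G1 ea.ge hp1) with h | h | h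
    · have := hmono a _ G2 (fun s hs => hs.1) k2.left_mem
      obtain ⟨A, hA, u, hu, v, hv, e1, e2, e3, e4⟩ := big2 a ha b hb hap hpb (by linarith) (by linarith)
      exact ⟨A, hA, u, hu, v, hv, e1, e2, e3, Or.inr (Or.inl e4)⟩
    · have := hmono b _ G1 (fun s hs => hs.1) k1.left_mem
      obtain ⟨A, hA, u, hu, v, hv, e1, e2, e3, e4⟩ := big1 a ha b hb hap hpb (by linarith) (by linarith)
      exact ⟨A, hA, u, hu, v, hv, e1, e2, e3, Or.inl e4⟩
    · obtain ⟨A, hA, e3, c, hc, c', hc', hcc, hcA⟩ := h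
      exact ⟨A, hA, a, ha, b, hb, hap, hpb, fun s hs h6 h7 => by linarith [e3 s ⟨hs, h6, h7⟩],
        Or.inr (Or.inr ⟨Or.inl ⟨⟨a', ha', by linarith⟩, ⟨b', hb', by linarith⟩⟩,
          c, hc.1, c', hc'.1, by linarith, by linarith⟩)⟩
  · obtain ⟨a', ha', hda⟩ := hG2.exists_near a
    obtain ⟨b', hb', hdb⟩ := hG1.exists_near b
    have k1 := hG1.sub hG1.left_mem hb' (by simp)
    have k2 := hG2.sub hG2.left_mem ha' (by simp)
    rcases triangle_cut hX hθ hν h3 hr0 hr1 hr2 hsub k2 k1 (by linarith) (by linarith)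
      (hf2 _ fun s hs => hs.1) (hf1 _ fun s hs => hs.1) (hab G2 ea.ge hp2) with h | h | h
    · have := hmono a _ G1 (fun s hs => hs.1) k1.left_mem
      obtain ⟨A, hA, u, hu, v, hv, e1, e2, e3, e4⟩ := big1 a ha b hb hap hpb (by linarith) (by linarith)
      exact ⟨A, hA, u, hu, v, hv, e1, e2, e3, Or.inl e4⟩
    · have := hmono b _ G2 (fun s hs => hs.1) k2.left_mem
      obtain ⟨A, hA, u, hu, v, hv, e1, e2, e3, e4⟩ := big2 a ha b hb hap hpb (by linarith) (by linarith)
      exact ⟨A, hA, u, hu, v, hv, e1, e2, e3, Or.inr (Or.inl e4)⟩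
    · obtain ⟨A, hA, e3, c, hc, c', hc', hcc, hcA⟩ := h
      have hcA' : infDist c' A ≤ 150 * r + χ := by
        have := infDist_le_infDist_add_dist (s := A) (x := c') (y := c)
        rw [dist_comm c' c] at this
        linarith
      exact ⟨A, hA, a, ha, b, hb, hap, hpb, fun s hs h6 h7 => by linarith [e3 s ⟨hs, h6, h7⟩],
        Or.inr (Or.inr ⟨Or.inr ⟨⟨a', ha', by linarith⟩, ⟨b', hb', by linarith⟩⟩,
          c', hc'.1, c, hc.1, by rw [dist_comm]; linarith, hcA'⟩)⟩
  · obtain ⟨A, hA, u, hu, v, hv, e1, e2, e3, e4⟩ := big2 a ha b hb hap hpb (by linarith) (by linarith)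
    exact ⟨A, hA, u, hu, v, hv, e1, e2, e3, Or.inr (Or.inl e4)⟩

/-! ### Coarse geometry of pieces -/

theorem beta2_seg {𝓐 : Set (Set X)} {ε M : ℝ} (h2 : Beta2With 𝓐 ε M) {A : Set X} (hA : A ∈ 𝓐)
    {T : Set X} {u v : X} (hT : IsSeg T u v) (hu : infDist u A < ε * dist u v)
    (hv : infDist v A < ε * dist u v) : ∃ m ∈ T, dist u m = dist u v / 2 ∧ infDist m A < M := by
  obtain ⟨γ, ℓ, hg, rfl, rfl, rfl⟩ := hT
  have e : ∀ t ∈ Icc 0 ℓ, dist (γ 0) (γ t) = t := by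
    intro t ht
    rw [hg.2 0 ⟨le_rfl, hg.1⟩ t ht, abs_of_nonpos (by linarith [ht.1])]; ring
  have hl := hg.1
  rw [e ℓ ⟨hl, le_rfl⟩] at *
  have hm : ℓ / 2 ∈ Icc 0 ℓ := ⟨by linarith, by linarith⟩
  exact ⟨γ (ℓ / 2), ⟨_, hm, rfl⟩, e _ hm,
    h2 γ ℓ hg A hA hu hv (ℓ / 2) ⟨by linarith, by linarith⟩⟩

/-- quasi-convexity of the pieces -/
def QConv (𝓐 : Set (Set X)) : Prop :=
  ∀ K : ℝ, ∃ Q, K ≤ Q ∧ ∀ A ∈ 𝓐, ∀ (S : Set X) (x y : X), IsSeg S x y → infDist x A ≤ K →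
    infDist y A ≤ K → ∀ s ∈ S, infDist s A ≤ Q

theorem qconv_of_beta2 {𝓐 : Set (Set X)} {ε M : ℝ} (hε : 0 < ε) (hM : 0 ≤ M)
    (h2 : Beta2With 𝓐 ε M) : QConv 𝓐 := by
  intro K
  obtain ⟨K', hK'⟩ : ∃ K', K' = max K (M + 1) := ⟨_, rfl⟩
  have hK1 : K ≤ K' := hK' ▸ le_max_left _ _
  have hK2 : M + 1 ≤ K' := hK' ▸ le_max_right _ _
  have hpos : 0 ≤ K' / ε := by apply div_nonneg <;> linarith
  refine ⟨K' + K' / ε, by linarith, ?_⟩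
  intro A hA S x y hS hx hy p hp
  by_cases hpK : infDist p A ≤ K'
  · linarith
  push Not at hpK
  obtain ⟨u, hu, -, hup, hur, humax⟩ := hS.crossing (continuous_infDist_pt A) hS.left_mem hp
    (by simp) (hx.trans hK1) hpK.le
  obtain ⟨v, hv, hpv, -, hvr, hvmax⟩ := hS.crossing' (continuous_infDist_pt A) hp hS.right_mem
    (hS.dist_le_right hp) hpK.le (hy.trans hK1)
  have hsub := hS.sub hu hv (hup.trans hpv)
  have hlen : dist u v ≤ K' / ε := by
    by_contra hc
    push Not at hc
    rw [div_lt_iff₀ hε] at hc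
    obtain ⟨m, hm, -, hmM⟩ := beta2_seg h2 hA hsub (by rw [hur]; linarith) (by rw [hvr]; linarith)
    have : K' ≤ infDist m A := by
      rcases le_total (dist x m) (dist x p) with h4 | h4
      · exact humax m hm.1 hm.2.1 h4
      · exact hvmax m hm.1 h4 hm.2.2
    linarith
  have h1 := infDist_le_infDist_add_dist (s := A) (x := p) (y := u)
  rw [dist_comm p u, hS.dist_le hu hp hup] at h1
  rw [hS.dist_le hu hv (hup.trans hpv)] at hlen
  linarith

/-- bounded coarse intersections of pieces -/
def BInter (𝓐 : Set (Set X)) : Prop :=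
  ∀ K : ℝ, ∃ D, 0 ≤ D ∧ ∀ A ∈ 𝓐, ∀ A' ∈ 𝓐, ∀ x y : X, infDist x A ≤ K → infDist x A' ≤ K →
    infDist y A ≤ K → infDist y A' ≤ K → D < dist x y → A = A'

theorem binter_of_alpha1 {𝓐 : Set (Set X)} (h1 : Alpha1 𝓐) : BInter 𝓐 := by
  intro K
  obtain ⟨D, hD⟩ := h1 (|K| + 1) (by positivity)
  refine ⟨|D|, abs_nonneg _, ?_⟩
  intro A hA A' hA' x y a1 a2 a3 a4 hxy
  by_contra hne
  have hK : K < |K| + 1 := by linarith [le_abs_self K]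
  have := hD A hA A' hA' hne x ⟨lt_of_le_of_lt a1 hK, lt_of_le_of_lt a2 hK⟩ y
    ⟨lt_of_le_of_lt a3 hK, lt_of_le_of_lt a4 hK⟩
  linarith [le_abs_self D]

/-- Property P1: geodesics to a piece pass near the projection. -/
def Proj1 (𝓐 : Set (Set X)) : Prop :=
  ∀ K : ℝ, 0 ≤ K → ∃ C, 0 ≤ C ∧ ∀ A ∈ 𝓐, ∀ x π a : X, infDist π A ≤ K →
    dist x π ≤ infDist x A + K → infDist a A ≤ K → ∀ S, IsSeg S x a → Near C π S

theorem proj1 (hX : GeodesicSpace X) {𝓐 : Set (Set X)} {R : ℝ} (hR : 0 < R) (hT : Thin 𝓐 R)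
    (hQ : QConv 𝓐) (hD : BInter 𝓐) : Proj1 𝓐 := by
  intro K hK
  obtain ⟨Q, hKQ, hQ⟩ := hQ K
  obtain ⟨D, hD0, hD⟩ := hD (Q + R)
  obtain ⟨C0, hC0⟩ : ∃ C0, C0 = K + Q + 2 * R := ⟨_, rfl⟩
  obtain ⟨C1, hC1⟩ : ∃ C1, C1 = C0 + D + 1 := ⟨_, rfl⟩
  refine ⟨C1 + 2 * R + K, by linarith, ?_⟩
  intro A hA x π a hπ hxπ ha S hS
  by_cases hpa : dist π a ≤ C1
  · exact ⟨a, hS.right_mem, by linarith⟩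
  push Not at hpa
  obtain ⟨T, hTs⟩ := hX.exists_seg π a
  obtain ⟨G, hG⟩ := hX.exists_seg x π
  obtain ⟨p, hp, hpd⟩ := hTs.exists_at (r := C1) (by linarith) hpa.le
  have hs1 : ∀ s ∈ G, dist s π ≤ infDist s A + K := by
    intro s hs
    have e1 := hG.dist_add hs
    have e2 := infDist_le_infDist_add_dist (s := A) (x := x) (y := s)
    linarith
  have hnear : ∀ q ∈ T, Near R q G → dist π q ≤ C0 := by
    rintro q hq ⟨s, hs, hqs⟩
    have e1 := hQ A hA T π a hTs hπ ha q hq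
    have e2 := infDist_le_infDist_add_dist (s := A) (x := s) (y := q)
    have e3 := hs1 s hs
    have e4 := dist_triangle π s q
    rw [dist_comm s q] at e2 e4
    rw [dist_comm π s] at e4
    linarith
  rcases hT π a x T G S hTs hG hS p hp with h | h | ⟨A', hA', u, hu, v, hv, hup, hpv, hin, h⟩
  · linarith [hnear p hp h]
  · exact h.of_dist (by linarith)
  · have hnv : ¬ Near R v G := fun hc => by linarith [hnear v hv hc]
    by_cases hun : Near R u S
    · exact hun.of_dist (by linarith)
    rcases h with h | h | ⟨h, c, hc, c', hc', hcc, hcA⟩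
    · exact absurd h.2 hnv
    · exact absurd h.1 hun
    · rcases h with h | h
      · have e1 := hnear u hu h.1
        have hAA : A = A' := by
          refine hD A hA A' hA' u p ?_ ?_ ?_ ?_ ?_
          · linarith [hQ A hA T π a hTs hπ ha u hu]
          · linarith [hin u hu le_rfl (hup.trans hpv)]
          · linarith [hQ A hA T π a hTs hπ ha p hp]
          · linarith [hin p hp hup hpv]
          · rw [hTs.dist_le hu hp hup]; linarith
        subst hAA
        have e2 := hs1 c hc
        refine ⟨c', hc', ?_⟩
        have e3 := dist_triangle π c c'
        rw [dist_comm π c] at e3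
        linarith
      · exact absurd h.1 hun

/-- `π` is an almost nearest point projection of `x` to `A`. -/
def IsPr (A : Set X) (x π : X) : Prop := π ∈ A ∧ dist x π ≤ infDist x A + 1

theorem exists_pr {A : Set X} (hA : A.Nonempty) (x : X) : ∃ π, IsPr A x π := by
  obtain ⟨π, h1, h2⟩ := (infDist_lt_iff hA).1 (show infDist x A < infDist x A + 1 by linarith)
  exact ⟨π, h1, h2.le⟩

theorem proj1_mem {𝓐 : Set (Set X)} (hP : Proj1 𝓐) (K : ℝ) (hK : 1 ≤ K) : ∃ C, 0 ≤ C ∧ ∀ A ∈ 𝓐,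
    ∀ x y π q : X, IsPr A x π → ∀ S, IsSeg S x y → q ∈ S → infDist q A ≤ K →
      ∃ s ∈ S, dist x s ≤ dist x q ∧ dist π s ≤ C := by
  obtain ⟨C, hC0, hC⟩ := hP K (by linarith)
  refine ⟨C, hC0, ?_⟩
  intro A hA x y π q hπ S hS hq hqA
  have hsub := hS.sub hS.left_mem hq (by simp)
  obtain ⟨s, hs, hd⟩ := hC A hA x π q (by rw [infDist_zero_of_mem hπ.1]; linarith)
    (by linarith [hπ.2]) hqA _ hsub
  exact ⟨s, hs.1, hs.2.2, hd⟩

/-- Property P2. -/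
def Proj2 (𝓐 : Set (Set X)) (C : ℝ) : Prop :=
  ∀ A ∈ 𝓐, ∀ x y πx πy : X, IsPr A x πx → IsPr A y πy → C < dist πx πy →
    ∀ S, IsSeg S x y → Near C πx S

theorem proj2 (hX : GeodesicSpace X) {𝓐 : Set (Set X)} {R : ℝ} (hR : 0 < R) (hT : Thin 𝓐 R)
    (hQ : QConv 𝓐) (hD : BInter 𝓐) : ∃ C, 0 ≤ C ∧ Proj2 𝓐 C := by
  obtain ⟨C1, hC10, hC1⟩ := proj1 hX hR hT hQ hD 1 (by norm_num)
  obtain ⟨Q, hKQ, hQ⟩ := hQ C1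
  obtain ⟨D, hD0, hD⟩ := hD (Q + R)
  obtain ⟨B, hB⟩ : ∃ B, B = Q + 3 * R + 1 := ⟨_, rfl⟩
  obtain ⟨C3, hC3⟩ : ∃ C3, C3 = D + B + 1 := ⟨_, rfl⟩
  refine ⟨2 * C1 + 2 * C3 + 2 * R + 1, by linarith, ?_⟩
  intro A hA x y πx πy hx hy hlt S hS
  obtain ⟨g, hg⟩ := hX.exists_seg x πy
  obtain ⟨G, hG⟩ := hX.exists_seg y πy
  obtain ⟨π', hπ', hπd⟩ := hC1 A hA x πx πy (by rw [infDist_zero_of_mem hx.1]; norm_num) hx.2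
    (by rw [infDist_zero_of_mem hy.1]; norm_num) g hg
  have hπA : infDist π' A ≤ C1 := by
    have := infDist_le_dist_of_mem (x := π') hx.1
    rw [dist_comm] at this
    linarith
  have hπy : 2 * C3 < dist π' πy := by
    have := dist_triangle πx π' πy
    linarith
  have hπy' := hg.dist_add hπ'
  obtain ⟨p, hp, hpd⟩ := hg.exists_at (r := dist x π' + C3)
    (by have := dist_nonneg (x := x) (y := π'); linarith) (by linarith)
  have hpy := hg.dist_add hp
  have hnear : ∀ q ∈ g, infDist q A ≤ Q + R → Near R q G → dist q πy ≤ B := by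
    rintro q hq e1 ⟨s, hs, hqs⟩
    have e2 := infDist_le_infDist_add_dist (s := A) (x := s) (y := q)
    have e3 := hG.dist_add hs
    have e4 := infDist_le_infDist_add_dist (s := A) (x := y) (y := s)
    have e5 := hy.2
    have e6 := dist_triangle q s πy
    rw [dist_comm s q] at e2
    linarith
  have hqA : ∀ q ∈ g, dist x π' ≤ dist x q → infDist q A ≤ Q := by
    intro q hq h1
    exact hQ A hA _ _ _ (hg.sub hπ' hg.right_mem (hg.dist_le_right hπ')) hπA
      (by rw [infDist_zero_of_mem hy.1]; linarith) q ⟨hq, h1, hg.dist_le_right hq⟩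
  have hfin : ∀ q ∈ g, dist π' q ≤ C3 + R + C1 + 1 → Near R q S →
      Near (2 * C1 + 2 * C3 + 2 * R + 1) πx S := by
    intro q hq h1 h2
    have := dist_triangle πx π' q
    exact h2.of_dist (by linarith)
  rcases hT x πy y g S G hg hS.symm hG p hp with h | h | ⟨A', hA', u, hu, v, hv, hup, hpv, hin, h⟩
  · exact hfin p hp (by rw [hg.dist_le hπ' hp (by linarith)]; linarith) h
  · have := hnear p hp (by linarith [hqA p hp (by linarith)]) h
    linarith
  · have huy := hg.dist_add hu
    rcases le_total (dist x π') (dist x u) with hc | hc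
    · have e1 : ¬ Near R u G := fun hn => by
        have := hnear u hu (by linarith [hqA u hu hc]) hn
        linarith
      have e2 : Near R u S := by tauto
      exact hfin u hu (by rw [hg.dist_le hπ' hu hc]; linarith) e2
    · have hAA : A = A' := by
        refine hD A hA A' hA' π' p ?_ ?_ ?_ ?_ ?_
        · linarith
        · linarith [hin π' hπ' hc (by linarith)]
        · linarith [hqA p hp (by linarith)]
        · linarith [hin p hp hup hpv]
        · rw [hg.dist_le hπ' hp (by linarith)]; linarith
      subst hAA
      have huA := hin u hu le_rfl (by linarith)
      have hup' := hg.dist_le hu hπ' hc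
      have hclose : dist u π' ≤ R + C1 + 1 := by
        have e1 := infDist_le_infDist_add_dist (s := A) (x := x) (y := u)
        have e2 := hx.2
        have e3 := dist_triangle x πx π'
        linarith
      have e1 : ¬ Near R u G := fun hn => by
        have := hnear u hu (by linarith) hn
        linarith
      have e2 : Near R u S := by tauto
      exact hfin u hu (by rw [dist_comm]; linarith) e2

/-! ### Deep points and chains -/

/-- `p` is a deep point of the segment `S` starting at `x`. -/
def Deep (𝓐 : Set (Set X)) (K L : ℝ) (S : Set X) (x p : X) : Prop :=
  ∃ A ∈ 𝓐, ∃ u ∈ S, ∃ v ∈ S, infDist u A ≤ K ∧ infDist v A ≤ K ∧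
    dist x u + L ≤ dist x p ∧ dist x p + L ≤ dist x v

theorem deep_lift {𝓐 : Set (Set X)} {ε M : ℝ} (hε : 0 < ε) (h2 : Beta2With 𝓐 ε M) (hQ : QConv 𝓐)
    (C L : ℝ) (hL : 0 ≤ L) : ∃ L1, 0 ≤ L1 ∧ ∀ (S : Set X) (x y p : X), IsSeg S x y → p ∈ S →
      Deep 𝓐 C L1 S x p → Deep 𝓐 M L S x p := by
  obtain ⟨Q, hCQ, hQ⟩ := hQ C
  have hpos : 0 ≤ (|Q| + 1) / ε := by positivity
  refine ⟨2 * L + (|Q| + 1) / ε, by linarith, ?_⟩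
  rintro S x y p hS hp ⟨A, hA, u, hu, v, hv, huA, hvA, hup, hpv⟩
  have hlt : ∀ ℓ, 2 * L + (|Q| + 1) / ε ≤ ℓ → Q < ε * ℓ := by
    intro ℓ hl
    have : (|Q| + 1) / ε ≤ ℓ := by linarith
    rw [div_le_iff₀ hε] at this
    linarith [le_abs_self Q]
  have hpA : infDist p A ≤ Q := hQ A hA _ _ _ (hS.sub hu hv (by linarith)) huA hvA p
    ⟨hp, by linarith, by linarith⟩
  have d1 := hS.dist_le hu hp (by linarith)
  have d2 := hS.dist_le hp hv (by linarith)
  have l1 := hlt (dist u p) (by linarith)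
  have l2 := hlt (dist p v) (by linarith)
  obtain ⟨m, hm, hmd, hmA⟩ := beta2_seg h2 hA (hS.sub hu hp (by linarith))
    (by linarith) (by linarith)
  obtain ⟨m', hm', hmd', hmA'⟩ := beta2_seg h2 hA (hS.sub hp hv (by linarith))
    (by linarith) (by linarith)
  refine ⟨A, hA, m, hm.1, m', hm'.1, hmA.le, hmA'.le, ?_, ?_⟩
  · rw [hS.dist_le hu hm.1 hm.2.1] at hmd
    linarith
  · rw [hS.dist_le hp hm'.1 hm'.2.1] at hmd'
    linarith

theorem Deep.mono {𝓐 : Set (Set X)} {K K' L L' : ℝ} {S : Set X} {x p : X} (h : Deep 𝓐 K L S x p)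
    (hK : K ≤ K') (hL : L' ≤ L) : Deep 𝓐 K' L' S x p := by
  obtain ⟨A, hA, u, hu, v, hv, huA, hvA, hup, hpv⟩ := h
  exact ⟨A, hA, u, hu, v, hv, by linarith, by linarith, by linarith, by linarith⟩

theorem chain_deep (hX : GeodesicSpace X) {𝓐 : Set (Set X)} {R K ε M C2 : ℝ} (hR : 0 < R)
    (hne : ∀ A ∈ 𝓐, A.Nonempty)
    (hT : Thin 𝓐 R) (hQ : QConv 𝓐) (hε : 0 < ε) (hM : 0 ≤ M) (h2 : Beta2With 𝓐 ε M)
    (hK1 : R ≤ K) (hK2 : M ≤ K) (hP1 : Proj1 𝓐) (hC2 : 0 ≤ C2) (hP2 : Proj2 𝓐 C2) (n : ℕ) :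
    ∀ L, 0 ≤ L → ∃ C, 0 ≤ C ∧ ∀ (z : ℕ → X) (H : ℕ → Set X),
      (∀ i < n, IsSeg (H i) (z i) (z (i + 1))) → ∀ S, IsSeg S (z n) (z 0) → ∀ p ∈ S,
      ¬ Deep 𝓐 K L S (z n) p → Near C p {z n} ∨ ∃ i < n, Near C p (H i) := by
  induction n with
  | zero =>
    intro L hL
    refine ⟨0, le_rfl, ?_⟩
    intro z H hH S hS p hp _
    left
    have := hS.dist_add hp
    rw [dist_self, dist_comm p] at this
    have := dist_nonneg (x := z 0) (y := p)
    exact ⟨z 0, rfl, by rw [dist_comm]; linarith⟩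
  | succ n ih =>
    intro L hL
    obtain ⟨Q, hKQ, hQ'⟩ := hQ K
    obtain ⟨B, hB⟩ : ∃ B, B = R + L := ⟨_, rfl⟩
    obtain ⟨Ck, hCk0, hCk⟩ := proj1_mem hP1 (Q + B + K + 1) (by linarith)
    obtain ⟨L1, hL1, hlift⟩ := deep_lift hε h2 hQ Ck L hL
    obtain ⟨L', hL'⟩ : ∃ L', L' = 2 * Ck + B + L1 + C2 + 1 := ⟨_, rfl⟩
    obtain ⟨C, hC0, hC⟩ := ih L' (by linarith)
    refine ⟨C + B + C2 + L1 + Ck, by linarith, ?_⟩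
    intro z H hH S hS p hp hdeep
    have hH0 := hH 0 (by omega)
    obtain ⟨G, hG⟩ := hX.exists_seg (z (n + 1)) (z 1)
    have main : Near B p G → Near (C + B + C2 + L1 + Ck) p {z (n + 1)} ∨
        ∃ i < n + 1, Near (C + B + C2 + L1 + Ck) p (H i) := by
      rintro ⟨p1, hp1, hpp⟩
      by_cases hd : Deep 𝓐 K L' G (z (n + 1)) p1
      · right
        refine ⟨0, by omega, ?_⟩
        obtain ⟨A, hA, u, hu, v, hv, huA, hvA, hup, hpv⟩ := hd
        have hp1A : infDist p1 A ≤ Q := hQ' A hA _ _ _ (hG.sub hu hv (by linarith)) huA hvA p1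
          ⟨hp1, by linarith, by linarith⟩
        have hpA : infDist p A ≤ Q + B := by
          have := infDist_le_infDist_add_dist (s := A) (x := p) (y := p1)
          linarith
        obtain ⟨πx, hπx⟩ := exists_pr (hne A hA) (z (n + 1))
        obtain ⟨π0, hπ0⟩ := exists_pr (hne A hA) (z 0)
        obtain ⟨π1, hπ1⟩ := exists_pr (hne A hA) (z 1)
        obtain ⟨s0, hs0, hs0u, hs0d⟩ := hCk A hA _ _ _ u hπx G hG hu (by linarith)
        obtain ⟨t0, ht0, ht0p, ht0d⟩ := hCk A hA _ _ _ p hπx S hS hp (by linarith)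
        obtain ⟨t1, ht1, ht1p, ht1d⟩ := hCk A hA _ _ _ p hπ0 S hS.symm hp (by linarith)
        obtain ⟨s1, hs1, hs1v, hs1d⟩ := hCk A hA _ _ _ v hπ1 G hG.symm hv (by linarith)
        have e1 := hG.dist_le hs0 hp1 (by linarith)
        have e2 : dist s0 p1 ≤ dist πx s0 + dist πx t0 + dist t0 p + dist p p1 := by
          have a1 := dist_triangle s0 πx t0
          have a2 := dist_triangle s0 t0 p
          have a3 := dist_triangle s0 p p1
          rw [dist_comm s0 πx] at a1
          linarith
        have e3 := hS.dist_le ht0 hp ht0p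
        have hGs1 := hG.symm.dist_add hs1
        have hGv := hG.symm.dist_add hv
        have hSt1 := hS.symm.dist_add ht1
        have hSp := hS.symm.dist_add hp
        rw [dist_comm s1] at hGs1
        rw [dist_comm v] at hGv
        rw [dist_comm t1] at hSt1
        rw [dist_comm p (z (n+1))] at hSp
        have e4 := hG.dist_le hp1 hs1 (by linarith)
        have e5 := hS.dist_le hp ht1 (by linarith)
        have t0A : infDist t0 A ≤ Ck := by
          have := infDist_le_dist_of_mem (x := t0) hπx.1
          rw [dist_comm] at this
          linarith
        have t1A : infDist t1 A ≤ Ck := by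
          have := infDist_le_dist_of_mem (x := t1) hπ0.1
          rw [dist_comm] at this
          linarith
        have hclose : dist p t1 < L1 := by
          by_contra hc
          push Not at hc
          exact hdeep ((hlift S _ _ p hS hp ⟨A, hA, t0, ht0, t1, ht1, t0A, t1A, by linarith,
            by linarith⟩).mono hK2 le_rfl)
        have hpp0 : dist p π0 ≤ L1 + Ck := by
          have := dist_triangle p t1 π0
          rw [dist_comm t1 π0] at this
          linarith
        have hfar : C2 < dist π0 π1 := by
          have a1 := dist_triangle4 p1 p π0 π1
          have a2 := dist_triangle p1 π1 s1
          rw [dist_comm p1 p] at a1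
          linarith
        exact (hP2 A hA _ _ _ _ hπ0 hπ1 hfar _ hH0).of_dist (by linarith)
      · rcases hC (fun i => z (i + 1)) (fun i => H (i + 1)) (fun i hi => hH (i + 1) (by omega)) G hG p1
          hp1 hd with h | ⟨i, hi, h⟩
        · exact Or.inl (h.of_dist (by linarith))
        · exact Or.inr ⟨i + 1, by omega, h.of_dist (by linarith)⟩
    rcases hT _ _ _ S G (H 0) hS hG.symm hH0.symm p hp with
      h | h | ⟨A, hA, u, hu, v, hv, hup, hpv, hin, h⟩
    · exact main (h.mono (by linarith))
    · exact Or.inr ⟨0, by omega, h.mono (by linarith)⟩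
    · have huA := hin u hu le_rfl (hup.trans hpv)
      have hvA := hin v hv (hup.trans hpv) le_rfl
      have hun : Near R u G ∨ Near R u (H 0) := by tauto
      have hvn : Near R v G ∨ Near R v (H 0) := by tauto
      have fin : ∀ w, dist p w ≤ L → (Near R w G ∨ Near R w (H 0)) →
          Near (C + B + C2 + L1 + Ck) p {z (n + 1)} ∨
          ∃ i < n + 1, Near (C + B + C2 + L1 + Ck) p (H i) := by
        rintro w hw (h | h)
        · exact main (h.of_dist (by linarith))
        · exact Or.inr ⟨0, by omega, h.of_dist (by linarith)⟩
      have d1 := hS.dist_le hu hp hup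
      have d2 := hS.dist_le hp hv hpv
      by_cases c1 : dist u p ≤ L
      · exact fin u (by rwa [dist_comm]) hun
      by_cases c2 : dist p v ≤ L
      · exact fin v c2 hvn
      push Not at c1 c2
      exact absurd ⟨A, hA, u, hu, v, hv, by linarith, by linarith, by linarith, by linarith⟩ hdeep

theorem chain_proj {𝓐 : Set (Set X)} {C2 : ℝ} (hne : ∀ A ∈ 𝓐, A.Nonempty) (hC2 : 0 ≤ C2)
    (hP2 : Proj2 𝓐 C2) (n : ℕ) : ∀ (z : ℕ → X) (H : ℕ → Set X),
      (∀ i < n, IsSeg (H i) (z i) (z (i + 1))) → ∀ A ∈ 𝓐, ∀ π π' : X, IsPr A (z 0) π →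
      IsPr A (z n) π' → (n + 1) * (C2 + 1) + dist (z n) (z n) < dist π π' → (0 < n ∨ π = π') →
      ∃ i < n, Near ((n + 1) * (C2 + 1)) π (H i) := by
  induction n with
  | zero =>
    intro z H _ A hA π π' h1 h2 h3 h4
    rcases h4 with h4 | h4
    · omega
    · subst h4
      rw [dist_self, dist_self] at h3
      push_cast at h3
      linarith
  | succ n ih =>
    intro z H hH A hA π π' h1 h2 h3 _
    rw [dist_self] at h3
    obtain ⟨π1, hπ1⟩ := exists_pr (hne A hA) (z 1)
    push_cast at h3 ⊢
    have hn : (0 : ℝ) ≤ n := by positivity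
    have hnC : 0 ≤ (n : ℝ) * C2 := by positivity
    by_cases hc : C2 < dist π π1
    · exact ⟨0, by omega, (hP2 A hA _ _ _ _ h1 hπ1 hc _ (hH 0 (by omega))).mono (by nlinarith)⟩
    · push Not at hc
      by_cases hn0 : n = 0
      · subst hn0
        refine ⟨0, by omega, (hP2 A hA _ _ _ _ h1 h2 ?_ _ (hH 0 (by omega))).mono (by nlinarith)⟩
        push_cast at h3
        linarith
      have ht := dist_triangle π π1 π'
      obtain ⟨i, hi, hni⟩ := ih (fun i => z (i + 1)) (fun i => H (i + 1))
        (fun i hi => hH (i + 1) (by omega)) A hA π1 π' hπ1 h2 (by rw [dist_self]; nlinarith)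
        (Or.inl (by omega))
      exact ⟨i + 1, by omega, hni.of_dist (by nlinarith)⟩


/-! ### Fat polygons, periodic form -/

/-- A fat geodesic `k`-gon, with periodic indexing of vertices and edges by natural numbers. -/
structure FatCyc (k : ℕ) (θ ν : ℝ) (V : ℕ → X) (E : ℕ → Set X) : Prop where
  seg : ∀ n, IsSeg (E n) (V n) (V (n + 1))
  perV : ∀ a b, a % k = b % k → V a = V b
  perE : ∀ a b, a % k = b % k → E a = E b
  F1 : ∀ n m, n % k ≠ m % k → ∀ p ∈ E n, 2 * θ ≤ dist p (V n) → 2 * θ ≤ dist p (V (n + 1)) →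
    ∀ q ∈ E m, q ∉ E n → θ ≤ dist p q
  F2 : ∀ n m, m % k ≠ n % k → (m + 1) % k ≠ n % k → ∀ q ∈ E m, ν * θ ≤ dist (V n) q

theorem fatCyc_of_polygon {k : ℕ} (hk : 3 ≤ k) {θ ν : ℝ} (P : PrePolygon X k)
    (hP : P.IsGeodesicPolygon) (hF : P.IsFat2 θ ν) :
    FatCyc k θ ν (fun n => P.vertex ⟨n % k, Nat.mod_lt _ (by omega)⟩)
      (fun n => P.edgeSet ⟨n % k, Nat.mod_lt _ (by omega)⟩) := by
  have hsucc : ∀ n, finCycSucc (⟨n % k, Nat.mod_lt _ (by omega)⟩ : Fin k) =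
      ⟨(n + 1) % k, Nat.mod_lt _ (by omega)⟩ := by
    intro n
    simp [finCycSucc]
  have hend : ∀ n, P.edge ⟨n % k, Nat.mod_lt _ (by omega)⟩ (P.len ⟨n % k, Nat.mod_lt _ (by omega)⟩)
      = P.vertex ⟨(n + 1) % k, Nat.mod_lt _ (by omega)⟩ := by
    intro n
    rw [hP.1.2, hsucc]; rfl
  constructor
  · intro n
    exact ⟨_, _, hP.2 _, rfl, hend n, rfl⟩
  · intro a b h
    simp only [h]
  · intro a b h
    simp only [h]
  · intro n m hnm p hp h0 h1 q hq hqn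
    have := hF.1 _ p hp h0 (by rw [hend]; exact h1)
    exact this.trans (infDist_le_dist_of_mem ⟨mem_iUnion.2 ⟨_, hq⟩, hqn⟩)
  · intro n m h1 h2 q hq
    refine (hF.2 ⟨n % k, Nat.mod_lt _ (by omega)⟩).trans (infDist_le_dist_of_mem ?_)
    refine mem_iUnion₂.2 ⟨⟨m % k, Nat.mod_lt _ (by omega)⟩, ⟨?_, ?_⟩, hq⟩
    · intro h
      exact h1 (congrArg Fin.val h)
    · intro h
      rw [hsucc] at h
      exact h2 (congrArg Fin.val h)

theorem FatCyc.close_aux {k : ℕ} {θ ν : ℝ} {V : ℕ → X} {E : ℕ → Set X}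
    (hθ : 0 < θ) (hν : 8 ≤ ν) (hF : FatCyc k θ ν V E) {n m ja jb : ℕ} (hnm : n % k ≠ m % k)
    (hseg : IsSeg (E m) (V ja) (V jb))
    (hinc : ∀ j, j % k = ja % k ∨ j % k = jb % k ∨ (m % k ≠ j % k ∧ (m + 1) % k ≠ j % k))
    (h1 : n % k ≠ jb % k) (h2 : (n + 1) % k ≠ jb % k)
    {u v : X} (hu : u ∈ E n) (hv : v ∈ E m) (huv : dist u v < θ) :
    (ja % k = n % k ∨ ja % k = (n + 1) % k) ∧ dist v (V ja) ≤ 3 * θ := by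
  have hfv : infDist v (E n) < θ := by
    have := infDist_le_dist_of_mem (x := v) hu
    rw [dist_comm] at this
    linarith
  have hνθ : 8 * θ ≤ ν * θ := by nlinarith
  have hfb : θ / 2 ≤ infDist (V jb) (E n) := by
    rw [le_infDist ⟨u, hu⟩]
    intro q hq
    have := hF.F2 jb n h1 h2 q hq
    linarith
  obtain ⟨v2, hv2, hvv2, hlt, hpos⟩ : ∃ v2 ∈ E m, dist (V ja) v ≤ dist (V ja) v2 ∧
      infDist v2 (E n) < θ ∧ 0 < infDist v2 (E n) := by
    by_cases hc : infDist v (E n) ≤ 0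
    · obtain ⟨w, hw, hw1, hw2, hw3, _⟩ := hseg.crossing (continuous_infDist_pt (E n)) hv
        hseg.right_mem (hseg.dist_le_right hv) (r := θ / 2) (by linarith) hfb
      exact ⟨w, hw, hw1, by linarith, by linarith⟩
    · push Not at hc
      exact ⟨v, hv, le_rfl, hfv, hc⟩
  obtain ⟨u2, hu2, hd2⟩ := (hF.seg n).exists_near v2
  have hv2n : v2 ∉ E n := by
    intro h
    rw [infDist_zero_of_mem h] at hpos
    exact lt_irrefl _ hpos
  have key : ∀ j, (j % k = n % k ∨ j % k = (n + 1) % k) → dist u2 (V j) < 2 * θ →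
      (ja % k = n % k ∨ ja % k = (n + 1) % k) ∧ dist v (V ja) ≤ 3 * θ := by
    intro j hj hd
    have ht := dist_triangle v2 u2 (V j)
    rcases hinc j with h | h | ⟨ha, hb⟩
    · rw [hF.perV j ja h] at ht hd
      refine ⟨by rw [← h]; exact hj, ?_⟩
      rw [dist_comm (V ja), dist_comm (V ja)] at hvv2
      linarith
    · rcases hj with hj | hj
      · exact absurd (hj.symm.trans h) h1
      · exact absurd (hj.symm.trans h) h2
    · have := hF.F2 j m ha hb v2 hv2
      rw [dist_comm] at this
      linarith
  by_cases c1 : 2 * θ ≤ dist u2 (V n)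
  · by_cases c2 : 2 * θ ≤ dist u2 (V (n + 1))
    · have := hF.F1 n m hnm u2 hu2 c1 c2 v2 hv2 hv2n
      rw [dist_comm] at this
      linarith
    · exact key (n + 1) (Or.inr rfl) (lt_of_not_ge c2)
  · exact key n (Or.inl rfl) (lt_of_not_ge c1)

theorem mod_succ_congr {k a b : ℕ} (h : a % k = b % k) : (a + 1) % k = (b + 1) % k :=
  Nat.ModEq.add_right 1 h

theorem mod_eq_bound {k a b : ℕ} (h : a % k = b % k) (hab : a ≤ b) (hb : b < a + k) : a = b := by
  have h1 : k ∣ b - a := (Nat.modEq_iff_dvd' hab).1 h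
  have := Nat.eq_zero_of_dvd_of_lt h1 (by omega)
  omega

theorem FatCyc.close {k : ℕ} (hk : 3 ≤ k) {θ ν : ℝ} {V : ℕ → X} {E : ℕ → Set X}
    (hθ : 0 < θ) (hν : 8 ≤ ν) (hF : FatCyc k θ ν V E) {n m : ℕ} (hnm : n % k ≠ m % k)
    {u v : X} (hu : u ∈ E n) (hv : v ∈ E m) (huv : dist u v < θ) :
    ∃ j, (j % k = n % k ∨ j % k = (n + 1) % k) ∧ (j % k = m % k ∨ j % k = (m + 1) % k) ∧
      dist v (V j) ≤ 3 * θ := by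
  by_cases h1 : (n + 1) % k = m % k
  · have := hF.close_aux hθ hν hnm (ja := m) (jb := m + 1) (hF.seg m) (by intro j; omega)
      (fun h => by
        have := mod_succ_congr h1
        have h3 := mod_eq_bound (h.trans this.symm) (by omega) (by omega)
        omega)
      (fun h => by
        rw [h1] at h
        have h3 := mod_eq_bound h (by omega) (by omega)
        omega) hu hv huv
    exact ⟨m, this.1, Or.inl rfl, this.2⟩
  · have := hF.close_aux hθ hν hnm (ja := m + 1) (jb := m) (hF.seg m).symm (by intro j; omega)
      hnm h1 hu hv huv
    exact ⟨m + 1, this.1, Or.inr rfl, this.2⟩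

theorem FatCyc.arc {𝓐 : Set (Set X)} {C2 : ℝ} (hne : ∀ A ∈ 𝓐, A.Nonempty) (hC2 : 0 ≤ C2)
    (hP2 : Proj2 𝓐 C2) {k : ℕ} {θ ν : ℝ} {V : ℕ → X} {E : ℕ → Set X}
    (hF : FatCyc k θ ν V E) {a b : ℕ} (hab : a < b) (hb : b ≤ a + k) {A : Set X} (hA : A ∈ 𝓐)
    {π π' : X} (h1 : IsPr A (V a) π) (h2 : IsPr A (V b) π')
    (h3 : (k + 1) * (C2 + 1) < dist π π') :
    (∃ i, a ≤ i ∧ i < b ∧ Near ((k + 1) * (C2 + 1)) π (E i)) ∧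
    (∃ i, a ≤ i ∧ i < b ∧ Near ((k + 1) * (C2 + 1)) π' (E i)) := by
  obtain ⟨n, rfl⟩ : ∃ n, b = a + n := ⟨b - a, by omega⟩
  have hn : (n : ℝ) ≤ k := by exact_mod_cast (by omega : n ≤ k)
  have hT : ((n : ℝ) + 1) * (C2 + 1) ≤ (k + 1) * (C2 + 1) := by nlinarith
  constructor
  · obtain ⟨i, hi, h⟩ := chain_proj hne hC2 hP2 n (fun i => V (a + i)) (fun i => E (a + i))
      (fun i _ => hF.seg (a + i)) A hA π π' h1 h2 (by rw [dist_self]; linarith) (Or.inl (by omega))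
    exact ⟨a + i, by omega, by omega, h.mono hT⟩
  · obtain ⟨i, hi, h⟩ := chain_proj hne hC2 hP2 n (fun i => V (a + n - i))
      (fun i => E (a + n - (i + 1)))
      (fun i hi => by
        have := (hF.seg (a + n - (i + 1))).symm
        rwa [show a + n - (i + 1) + 1 = a + n - i by omega] at this) A hA π' π h2
      (by simpa using h1) (by rw [dist_self, dist_comm π']; linarith) (Or.inl (by omega))
    exact ⟨a + n - (i + 1), by omega, by omega, h.mono hT⟩

/-- If `V m` is close to its projection then so is `V j` as soon as projections are far. -/
theorem FatCyc.vertex_near {𝓐 : Set (Set X)} {C2 : ℝ} (hne : ∀ A ∈ 𝓐, A.Nonempty) (hC2 : 0 ≤ C2)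
    (hP2 : Proj2 𝓐 C2) {k : ℕ} (hk : 3 ≤ k) {θ ν : ℝ} (hθ : 0 < θ) (hν : 8 ≤ ν)
    {V : ℕ → X} {E : ℕ → Set X}
    (hF : FatCyc k θ ν V E) (hT : 2 * ((k + 1) * (C2 + 1)) < θ) {m j : ℕ} (hmj : m < j)
    (hj : j < m + k) {A : Set X} (hA : A ∈ 𝓐) {πm πj : X} (h1 : IsPr A (V m) πm)
    (h2 : IsPr A (V j) πj) (hm : dist (V m) πm ≤ 4 * θ) (h3 : 8 * θ < dist πj πm) :
    dist (V j) πj ≤ 4 * θ := by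
  have hmk : V (m + k) = V m := hF.perV _ _ (by simp)
  have hT0 : 0 ≤ ((k : ℝ) + 1) * (C2 + 1) := by positivity
  obtain ⟨i1, a1, a2, q1, hq1, d1⟩ := (hF.arc hne hC2 hP2 hmj (by omega) hA h1 h2
    (by rw [dist_comm]; linarith)).2
  obtain ⟨i2, b1, b2, q2, hq2, d2⟩ := (hF.arc hne hC2 hP2 hj (by omega) hA h2
    (by rw [hmk]; exact h1) (by linarith)).1
  have hne12 : i1 % k ≠ i2 % k := fun h => by
    have := mod_eq_bound h (by omega) (by omega)
    omega
  obtain ⟨j0, hj1, hj2, hd⟩ := hF.close hk hθ hν hne12 hq1 hq2 (by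
    have := dist_triangle q1 πj q2
    rw [dist_comm q1 πj] at this
    linarith)
  have hj0 : dist (V j0) πj ≤ 4 * θ := by
    have := dist_triangle (V j0) q2 πj
    rw [dist_comm (V j0) q2, dist_comm q2 πj] at this
    linarith
  have hcase : j0 % k = j % k ∨ j0 % k = m % k := by
    rcases hj1 with hj1 | hj1 <;> rcases hj2 with hj2 | hj2
    · exact absurd (hj1.symm.trans hj2) hne12
    · right
      by_cases hc : i2 + 1 < i1 + k
      · have := mod_eq_bound (hj1.symm.trans hj2) (by omega) (by omega)
        omega
      · rw [hj1, show i1 = m by omega]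
    · left
      have := mod_eq_bound (hj1.symm.trans hj2) (by omega) (by omega)
      rw [hj1, show i1 + 1 = j by omega]
    · have := mod_eq_bound (hj1.symm.trans hj2) (by omega) (by omega)
      omega
  rcases hcase with h | h
  · rwa [hF.perV _ _ h] at hj0
  · rw [hF.perV _ _ h] at hj0
    have := dist_triangle πj (V m) πm
    rw [dist_comm πj (V m)] at this
    linarith

theorem FatCyc.piece {𝓐 : Set (Set X)} {C1 C2 C K L : ℝ} (hne : ∀ A ∈ 𝓐, A.Nonempty) (hC2 : 0 ≤ C2)
    (hP2 : Proj2 𝓐 C2) {k : ℕ} (hk : 3 ≤ k) {θ ν : ℝ} (hθ : 0 < θ) (hν : 100 ≤ ν)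
    {V : ℕ → X} {E : ℕ → Set X} (hF : FatCyc k θ ν V E)
    (hT : 2 * ((k + 1) * (C2 + 1)) < θ) (hTC : C1 + (k + 1) * (C2 + 1) < θ) (hCθ : C < θ)
    (hC1 : 0 ≤ C1)
    (hL : C1 + (k + 1) * (C2 + 1) < L)
    (hp1 : ∀ A ∈ 𝓐, ∀ x y π q : X, IsPr A x π → ∀ S, IsSeg S x y → q ∈ S → infDist q A ≤ K →
      ∃ s ∈ S, dist x s ≤ dist x q ∧ dist π s ≤ C1)
    (hch : ∀ (z : ℕ → X) (H : ℕ → Set X),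
      (∀ i < k - 1, IsSeg (H i) (z i) (z (i + 1))) → ∀ S, IsSeg S (z (k - 1)) (z 0) → ∀ p ∈ S,
      ¬ Deep 𝓐 K L S (z (k - 1)) p → Near C p {z (k - 1)} ∨ ∃ i < k - 1, Near C p (H i)) :
    ∃ A ∈ 𝓐, ∀ j < k, infDist (V j) A ≤ 4 * θ := by
  have hT0 : 0 ≤ ((k : ℝ) + 1) * (C2 + 1) := by positivity
  have hk0 : V k = V 0 := hF.perV _ _ (by simp)
  have hνθ : 100 * θ ≤ ν * θ := by nlinarith
  have h1k : 1 % k = 1 := Nat.mod_eq_of_lt (by omega)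
  have h2k : 2 % k = 2 := Nat.mod_eq_of_lt (by omega)
  have hlen : 100 * θ ≤ dist (V 0) (V 1) := by
    have := hF.F2 0 1 (by simp [h1k]) (by simp [h2k]) (V 1) (hF.seg 1).left_mem
    linarith
  have hS := hF.seg 0
  simp only [zero_add] at hS
  obtain ⟨p, hp, hpd⟩ := hS.exists_at (r := dist (V 0) (V 1) / 2) (by linarith) (by linarith)
  have hpd' := hS.dist_add hp
  have hfar : ∀ i, 1 ≤ i → i < k → ∀ s ∈ E 0, ∀ q ∈ E i, dist s q < θ →
      dist s (V 0) ≤ 3 * θ ∨ dist s (V 1) ≤ 3 * θ := by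
    intro i hi hik s hs q hq hd
    obtain ⟨j, _, hj, hjd⟩ := hF.close hk hθ (by linarith) (n := i) (m := 0)
      (by rw [Nat.mod_eq_of_lt hik]; simp; omega) hq hs (by rwa [dist_comm])
    rcases hj with hj | hj
    · left; rwa [hF.perV _ _ hj] at hjd
    · right; rwa [hF.perV _ _ hj] at hjd
  have hdeep : Deep 𝓐 K L (E 0) (V 0) p := by
    by_contra hnd
    have hz : V (1 + (k - 1)) = V 0 := by rw [show 1 + (k - 1) = k by omega, hk0]
    rcases hch (fun i => V (1 + i)) (fun i => E (1 + i)) (fun i _ => hF.seg (1 + i)) (E 0)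
      (by simp only [hz]; exact hS) p hp (by simp only [hz]; exact hnd) with ⟨s, hs, hd⟩ | ⟨i, hi, s, hs, hd⟩
    · simp only [hz, mem_singleton_iff] at hs
      rw [hs, dist_comm] at hd
      linarith
    · have := hfar (1 + i) (by omega) (by omega) p hp s hs (by linarith)
      rw [dist_comm p (V 0)] at this
      rcases this with h | h <;> linarith
  obtain ⟨A, hA, u, hu, v, hv, huA, hvA, hup, hpv⟩ := hdeep
  choose π hπ using fun j => exists_pr (hne A hA) (V j)
  obtain ⟨s0, hs0, hs0u, hd0⟩ := hp1 A hA _ _ _ u (hπ 0) _ hS hu huA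
  obtain ⟨s1, hs1, hs1v, hd1⟩ := hp1 A hA _ _ _ v (hπ 1) _ hS.symm hv hvA
  have hs1a := hS.dist_add hs1
  have hva := hS.dist_add hv
  rw [dist_comm s1] at hs1a
  rw [dist_comm v] at hva
  have hs01 := hS.dist_le hs0 hs1 (by linarith)
  have hπ01 : (k + 1) * (C2 + 1) < dist (π 1) (π 0) := by
    have := dist_triangle4 s0 (π 0) (π 1) s1
    rw [dist_comm s0 (π 0), dist_comm (π 0) (π 1)] at this
    linarith
  obtain ⟨⟨i, hi1, hi2, q, hq, hqd⟩, ⟨i', hi1', hi2', q', hq', hqd'⟩⟩ :=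
    hF.arc hne hC2 hP2 (a := 1) (b := k) (by omega) (by omega) hA (hπ 1)
      (by rw [hk0]; exact hπ 0) hπ01
  have hn1 : dist s1 (V 1) ≤ 3 * θ := by
    have ht := dist_triangle s1 (π 1) q
    rw [dist_comm s1 (π 1)] at ht
    rcases hfar i hi1 hi2 s1 hs1 q hq (by linarith) with h | h
    · rw [dist_comm] at h
      linarith
    · exact h
  have hn0 : dist s0 (V 0) ≤ 3 * θ := by
    have ht := dist_triangle s0 (π 0) q'
    rw [dist_comm s0 (π 0)] at ht
    rcases hfar i' hi1' hi2' s0 hs0 q' hq' (by linarith) with h | h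
    · exact h
    · have := hS.dist_add hs0
      linarith
  have hv0 : dist (V 0) (π 0) ≤ 4 * θ := by
    have ht := dist_triangle (V 0) s0 (π 0)
    rw [dist_comm (V 0) s0, dist_comm s0 (π 0)] at ht
    linarith
  have hv1 : dist (V 1) (π 1) ≤ 4 * θ := by
    have ht := dist_triangle (V 1) s1 (π 1)
    rw [dist_comm (V 1) s1, dist_comm s1 (π 1)] at ht
    linarith
  have hbig : 92 * θ ≤ dist (π 0) (π 1) := by
    have ht := dist_triangle4 (V 0) (π 0) (π 1) (V 1)
    rw [dist_comm (π 1) (V 1)] at ht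
    linarith
  refine ⟨A, hA, fun j hj => (infDist_le_dist_of_mem (hπ j).1).trans ?_⟩
  by_cases j0 : j = 0
  · subst j0; exact hv0
  by_cases j1 : j = 1
  · subst j1; exact hv1
  have htri := dist_triangle (π 0) (π j) (π 1)
  rw [dist_comm (π 0) (π j)] at htri
  by_cases hc : 8 * θ < dist (π j) (π 0)
  · exact hF.vertex_near hne hC2 hP2 hk hθ (by linarith) hT (m := 0) (by omega) (by omega) hA (hπ 0)
      (hπ j) hv0 hc
  · exact hF.vertex_near hne hC2 hP2 hk hθ (by linarith) hT (m := 1) (by omega) (by omega) hA (hπ 1)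
      (hπ j) hv1 (by linarith)

theorem alpha2_of_beta2 {𝓐 : Set (Set X)} (h2 : Beta2 𝓐) : Alpha2 𝓐 := by
  obtain ⟨ε, M, hε, hM, h2⟩ := h2
  refine ⟨min ε (1/4), M + 1, by positivity, lt_of_le_of_lt (min_le_right _ _) (by norm_num),
    by linarith, ?_⟩
  intro γ ℓ hγ A hA h0 h1
  have hℓ := hγ.1
  have hle : min ε (1/4) * ℓ ≤ ε * ℓ := mul_le_mul_of_nonneg_right (min_le_left _ _) hℓ
  have := h2 γ ℓ hγ A hA (lt_of_lt_of_le h0 hle) (lt_of_lt_of_le h1 hle) (ℓ / 2)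
    ⟨by linarith, by linarith⟩
  exact ⟨ℓ / 2, ⟨by linarith, by linarith⟩, lt_trans (show infDist _ A < M from this) (by linarith)⟩

theorem alpha3_of_beta (hX : GeodesicSpace X) {𝓐 : Set (Set X)} {η : ℝ}
    (h1 : Alpha1 𝓐) (h2 : Beta2 𝓐) (h3 : Beta3Eta 𝓐 η) : Alpha3 𝓐 := by
  intro k hk
  by_cases hemp : ∅ ∈ 𝓐
  · refine ⟨1, one_pos, 8, le_rfl, 1, one_pos, fun P _ _ => ⟨∅, hemp, fun x _ => ?_⟩⟩
    change infDist x ∅ < 1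
    rw [infDist_empty]; exact one_pos
  have hne : ∀ A ∈ 𝓐, A.Nonempty := by
    intro A hA
    by_contra hc
    rw [not_nonempty_iff_eq_empty] at hc
    exact hemp (hc ▸ hA)
  by_cases hk2 : k = 2
  · subst hk2
    refine ⟨1, one_pos, 8, le_rfl, 1, one_pos, fun P _ hF => ?_⟩
    exfalso
    have := hF.2 0
    have he : P.opp 0 = ∅ := by
      have : ∀ j : Fin 2, ¬ (j ≠ 0 ∧ finCycSucc j ≠ 0) := by decide
      ext x
      simp only [PrePolygon.opp, mem_iUnion, mem_ofPred_eq, mem_empty_iff_false, iff_false]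
      rintro ⟨j, hj, _⟩
      exact this j hj
    rw [he, infDist_empty] at this
    norm_num at this
  have hk3 : 3 ≤ k := by omega
  obtain ⟨ε, M, hε, hM, h2⟩ := h2
  obtain ⟨R, hR, hT⟩ := thin_of_beta3 hX h3
  have hQ := qconv_of_beta2 hε hM h2
  have hD := binter_of_alpha1 h1
  have hP1 := proj1 hX hR hT hQ hD
  obtain ⟨C2, hC2, hP2⟩ := proj2 hX hR hT hQ hD
  obtain ⟨C1, hC1, hp1⟩ := proj1_mem hP1 (R + M + 1) (by linarith)
  have hT0 : 0 ≤ ((k : ℝ) + 1) * (C2 + 1) := by positivity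
  obtain ⟨C, hC, hch⟩ := chain_deep hX hR hne hT hQ hε hM h2 (K := R + M + 1) (by linarith)
    (by linarith) hP1 hC2 hP2 (k - 1) (C1 + (k + 1) * (C2 + 1) + 1) (by linarith)
  obtain ⟨θ, hθ⟩ : ∃ θ, θ = C + C1 + 2 * ((k + 1) * (C2 + 1)) + 1 := ⟨_, rfl⟩
  obtain ⟨Q, hQ1, hQ2⟩ := hQ (4 * θ)
  refine ⟨θ, by linarith, 100, by norm_num, Q + 1, by linarith, fun P hP hF => ?_⟩
  have hcyc := fatCyc_of_polygon hk3 P hP hF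
  obtain ⟨A, hA, hv⟩ := hcyc.piece hne hC2 hP2 hk3 (by linarith) le_rfl (by linarith)
    (by linarith) (by linarith) hC1 (by linarith) hp1 hch
  refine ⟨A, hA, ?_⟩
  have hv' : ∀ i : Fin k, infDist (P.vertex i) A ≤ 4 * θ := by
    intro i
    have := hv i.1 i.2
    simpa [Nat.mod_eq_of_lt i.2] using this
  intro x hx
  obtain ⟨i, hi⟩ := mem_iUnion.1 hx
  have hs : IsSeg (P.edgeSet i) (P.vertex i) (P.vertex (finCycSucc i)) :=
    ⟨_, _, hP.2 i, rfl, hP.1.2 i, rfl⟩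
  have := hQ2 A hA _ _ _ hs (hv' _) (hv' _) x hi
  change infDist x A < Q + 1
  linarith

/-- **Proposition.** If a geodesic metric space `X` and a collection `𝓐` of subsets
satisfy (α₁), (β₂) and (β₃^η) for some `η > 0`, then `X` is asymptotically tree-graded
with respect to `𝓐`. -/
theorem atg_of_alpha1_beta2_beta3eta (hX : GeodesicSpace X) (𝓐 : Set (Set X))
    (η : ℝ) (hη : 0 < η)
    (h1 : Alpha1 𝓐) (h2 : Beta2 𝓐) (h3 : Beta3Eta 𝓐 η) : ATG 𝓐 := by
  exact ⟨h1, alpha2_of_beta2 h2, alpha3_of_beta hX h1 h2 h3⟩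
end

section
/- Let X be a geodesic metric space and 𝓐 a collection of subsets of X. If (X,𝓐) satisfies properties (α1), (Q) and (β3), then (X,𝓐) satisfies property (α2) for all sufficiently small ε > 0 (with a suitable constant M depending on ε), and (X,𝓐) satisfies property (β2). -/
open Set Metric

/-! ### Basic metric notions: tubular neighborhoods, geodesics -/

variable {X : Type*} [MetricSpace X]

/-! ### Helper lemmas -/

lemma tubAux_mem {x : X} {A : Set X} {δ : ℝ} (h : Metric.infDist x A < δ) : x ∈ tubN δ A := h

lemma geoAux_continuousOn {γ : ℝ → X} {l : ℝ} (h : IsGeodesicParam γ l) :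
    ContinuousOn γ (Set.Icc 0 l) := by
  have : LipschitzOnWith 1 γ (Set.Icc 0 l) := by
    apply LipschitzOnWith.of_dist_le_mul
    intro s hs t ht
    rw [h.2 s hs t ht, Real.dist_eq]
    simp
  exact this.continuousOn

lemma geoAux_add {γ : ℝ → X} {l : ℝ} (h : IsGeodesicParam γ l) {s : ℝ} (hs : s ∈ Set.Icc 0 l) :
    dist (γ 0) (γ s) + dist (γ s) (γ l) = dist (γ 0) (γ l) := by
  have h0 : (0:ℝ) ∈ Set.Icc 0 l := ⟨le_rfl, h.1⟩
  have hl : l ∈ Set.Icc 0 l := ⟨h.1, le_rfl⟩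
  rw [h.2 0 h0 s hs, h.2 s hs l hl, h.2 0 h0 l hl]
  rw [abs_of_nonpos (by linarith [hs.1]), abs_of_nonpos (by linarith [hs.2]),
    abs_of_nonpos (by linarith [h.1])]
  ring

/-- Sub-geodesic between two parameters, in any order. -/
lemma geoAux_sub {γ : ℝ → X} {l : ℝ} (h : IsGeodesicParam γ l) {a b : ℝ}
    (ha : a ∈ Set.Icc 0 l) (hb : b ∈ Set.Icc 0 l) :
    ∃ (η : ℝ → X) (L : ℝ), IsGeodesicParam η L ∧ η 0 = γ a ∧ η L = γ b ∧
      ∀ s ∈ Set.Icc 0 L, ∃ r, min a b ≤ r ∧ r ≤ max a b ∧ η s = γ r := by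
  obtain ⟨ha0, hal⟩ := ha
  obtain ⟨hb0, hbl⟩ := hb
  rcases le_total a b with hab | hab
  · refine ⟨fun s => γ (a + s), b - a, ⟨by linarith, ?_⟩, by simp, by simp, ?_⟩
    · rintro s ⟨hs0, hs1⟩ t ⟨ht0, ht1⟩
      rw [h.2 _ ⟨by linarith, by linarith⟩ _ ⟨by linarith, by linarith⟩]
      congr 1; ring
    · rintro s ⟨hs0, hs1⟩
      rw [min_eq_left hab, max_eq_right hab]
      exact ⟨a + s, by linarith, by linarith, rfl⟩
  · refine ⟨fun s => γ (a - s), a - b, ⟨by linarith, ?_⟩, by simp, by simp, ?_⟩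
    · rintro s ⟨hs0, hs1⟩ t ⟨ht0, ht1⟩
      rw [h.2 _ ⟨by linarith, by linarith⟩ _ ⟨by linarith, by linarith⟩, abs_sub_comm]
      congr 1; ring
    · rintro s ⟨hs0, hs1⟩
      rw [min_eq_right hab, max_eq_left hab]
      exact ⟨a - s, by linarith, by linarith, rfl⟩

/-- Nearest point on a geodesic. -/
lemma geoAux_proj {γ : ℝ → X} {l : ℝ} (h : IsGeodesicParam γ l) (x : X) :
    ∃ r ∈ Set.Icc 0 l, ∀ w ∈ Set.Icc 0 l, dist x (γ r) ≤ dist x (γ w) := by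
  have hc : ContinuousOn (fun r => dist x (γ r)) (Set.Icc 0 l) :=
    (continuous_const.dist continuous_id).comp_continuousOn (geoAux_continuousOn h)
  obtain ⟨r, hr, hm⟩ := isCompact_Icc.exists_isMinOn ⟨0, le_rfl, h.1⟩ hc
  exact ⟨r, hr, fun w hw => hm hw⟩

/-- Cutting a corner. -/
lemma geoAux_cut {γ : ℝ → X} {l : ℝ} (h : IsGeodesicParam γ l) {σ : ℝ → X} {S : ℝ}
    (hσ : IsGeodesicParam σ S) {a R : ℝ} (ha : a ∈ Set.Icc 0 l) (h0 : σ 0 = γ a) (hR : 0 ≤ R)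
    (hS : ∀ w ∈ Set.Icc 0 l, R ≤ dist (σ S) (γ w)) :
    ∃ s ∈ Set.Icc 0 S, ∃ r ∈ Set.Icc 0 l, dist (σ s) (γ r) = R ∧
      ∀ s' ∈ Set.Icc s S, ∀ w ∈ Set.Icc 0 l, R ≤ dist (σ s') (γ w) := by
  set G : Set X := γ '' Set.Icc 0 l with hG
  have hGn : G.Nonempty := ⟨_, a, ha, rfl⟩
  set f : ℝ → ℝ := fun s => Metric.infDist (σ s) G with hf
  have hfc : ContinuousOn f (Set.Icc 0 S) :=
    (Metric.continuous_infDist_pt G).comp_continuousOn (geoAux_continuousOn hσ)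
  have hfle : ∀ s, ∀ w ∈ Set.Icc 0 l, f s ≤ dist (σ s) (γ w) := fun s w hw =>
    Metric.infDist_le_dist_of_mem ⟨w, hw, rfl⟩
  have hf0 : f 0 ≤ R := by
    have := hfle 0 a ha
    rw [h0, dist_self] at this
    linarith
  have hfS : R ≤ f S := by
    refine (Metric.le_infDist hGn).2 ?_
    rintro _ ⟨w, hw, rfl⟩
    exact hS w hw
  have hK : IsCompact (Set.Icc 0 S ∩ f ⁻¹' Set.Iic R) := by
    apply isCompact_Icc.of_isClosed_subset _ Set.inter_subset_left
    exact hfc.preimage_isClosed_of_isClosed isClosed_Icc isClosed_Iic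
  obtain ⟨s, hs, hmax⟩ := hK.exists_isGreatest ⟨0, ⟨le_rfl, hσ.1⟩, hf0⟩
  have hsI : s ∈ Set.Icc 0 S := hs.1
  have hsR : f s ≤ R := hs.2
  have hfs : f s = R := by
    obtain ⟨s', hs', he⟩ := intermediate_value_Icc hsI.2
      (hfc.mono (Set.Icc_subset_Icc_left hsI.1)) ⟨hsR, hfS⟩
    have : s' ≤ s := hmax ⟨⟨hsI.1.trans hs'.1, hs'.2⟩, he.le⟩
    have : s' = s := le_antisymm this hs'.1
    rw [← this]; exact he
  obtain ⟨r, hr, hrm⟩ := geoAux_proj h (σ s)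
  refine ⟨s, hsI, r, hr, ?_, ?_⟩
  · apply le_antisymm
    · rw [← hfs]
      refine (Metric.le_infDist hGn).2 ?_
      rintro _ ⟨w, hw, rfl⟩
      exact hrm w hw
    · rw [← hfs]; exact hfle s r hr
  · intro s' hs' w hw
    refine le_trans ?_ (hfle s' w hw)
    by_contra hlt
    push Not at hlt
    have : s' ≤ s := hmax ⟨⟨hsI.1.trans hs'.1, hs'.2⟩, hlt.le⟩
    have : s' = s := le_antisymm this hs'.1
    rw [this, hfs] at hlt
    exact lt_irrefl _ hlt

/-- Fatness criterion. -/
lemma hexAux_fat (P : PrePolygon X 6) (hP : P.IsGeodesicPolygon) {θ ν : ℝ} (hθ : 0 < θ)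
    (hν : 8 ≤ ν)
    (hna : ∀ i j : Fin 6, i < j → j ≠ finCycSucc i → i ≠ finCycSucc j →
      ∀ p ∈ P.edgeSet i, ∀ q ∈ P.edgeSet j, ν * θ ≤ dist p q)
    (hadj : ∀ i : Fin 6,
      (∀ p ∈ P.edgeSet i, ∀ q ∈ P.edgeSet (finCycSucc i),
        dist p (P.edge (finCycSucc i) 0) ≤ dist p q) ∨
      (∀ p ∈ P.edgeSet i, ∀ q ∈ P.edgeSet (finCycSucc i),
        dist q (P.edge (finCycSucc i) 0) ≤ dist p q)) : P.IsFat2 θ ν := by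
  have hνθ : θ ≤ ν * θ := by nlinarith
  have hna' : ∀ i j : Fin 6, i ≠ j → j ≠ finCycSucc i → i ≠ finCycSucc j →
      ∀ p ∈ P.edgeSet i, ∀ q ∈ P.edgeSet j, ν * θ ≤ dist p q := by
    intro i j hij h1 h2 p hp q hq
    rcases lt_or_gt_of_ne hij with h | h
    · exact hna i j h h1 h2 p hp q hq
    · rw [dist_comm]; exact hna j i h h2 h1 q hq p hp
  have hst : ∀ i, P.edge i 0 ∈ P.edgeSet i := fun i => ⟨0, ⟨le_rfl, hP.1.1 i⟩, rfl⟩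
  have hen : ∀ i, P.edge i (P.len i) ∈ P.edgeSet i := fun i => ⟨_, ⟨hP.1.1 i, le_rfl⟩, rfl⟩
  refine ⟨?_, ?_⟩
  · intro i p hp hp0 hp1
    have hne : (P.carrier \ P.edgeSet i).Nonempty := by
      have : ∃ j : Fin 6, i ≠ j ∧ j ≠ finCycSucc i ∧ i ≠ finCycSucc j := by
        clear hp hp0 hp1; revert i; decide
      obtain ⟨j, h1, h2, h3⟩ := this
      refine ⟨P.edge j 0, Set.mem_iUnion.2 ⟨j, hst j⟩, fun hmem => ?_⟩
      have := hna' i j h1 h2 h3 _ hmem _ (hst j)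
      rw [dist_self] at this
      linarith
    refine (Metric.le_infDist hne).2 ?_
    rintro q ⟨hq, hqi⟩
    obtain ⟨j, hj⟩ := Set.mem_iUnion.1 hq
    have hij : i ≠ j := by rintro rfl; exact hqi hj
    by_cases h1 : j = finCycSucc i
    · subst h1
      rw [hP.1.2 i] at hp1
      have t1 := dist_triangle p q (P.edge (finCycSucc i) 0)
      rcases hadj i with h | h
      · have := h p hp q hj
        linarith
      · have := h p hp q hj
        linarith
    by_cases h2 : i = finCycSucc j
    · have t1 := dist_triangle p q (P.edge i 0)
      have h := hadj j
      rw [← h2] at h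
      rcases h with h | h
      · have := h q hj p hp
        rw [dist_comm q p] at this
        linarith
      · have := h q hj p hp
        rw [dist_comm q p] at this
        linarith
    exact hνθ.trans (hna' i j hij h1 h2 p hp q hj)
  · intro i
    have hne : (P.opp i).Nonempty := by
      have : ∃ j : Fin 6, j ≠ i ∧ finCycSucc j ≠ i := by revert i; decide
      obtain ⟨j, hj⟩ := this
      exact ⟨P.edge j 0, Set.mem_biUnion (show j ∈ {j : Fin 6 | j ≠ i ∧ finCycSucc j ≠ i} from hj)
        (hst j)⟩
    refine (Metric.le_infDist hne).2 ?_
    intro q hq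
    obtain ⟨j, ⟨hj1, hj2⟩, hqj⟩ := Set.mem_iUnion₂.1 hq
    by_cases h1 : j = finCycSucc i
    · have : ∃ k : Fin 6, finCycSucc k = i ∧ k ≠ j ∧ j ≠ finCycSucc k ∧ k ≠ finCycSucc j := by
        subst h1; clear hq hne hj1 hj2 hqj; revert i; decide
      obtain ⟨k, hk, h2, h3, h4⟩ := this
      have hv : P.vertex i ∈ P.edgeSet k := by
        have := hen k
        rw [hP.1.2 k, hk] at this
        exact this
      exact hna' k j h2 h3 h4 _ hv q hqj
    · exact hna' i j (Ne.symm hj1) h1 (Ne.symm hj2) _ (hst i) q hqj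

/-- Perpendicularity propagates along a geodesic. -/
lemma geoAux_perp {a z v w : X} (h : dist a z + dist z v = dist a v) (hw : dist a v ≤ dist a w) :
    dist z v ≤ dist z w := by
  have := dist_triangle a z w
  linarith

/-- The hexagon as a pre-polygon. -/
def hexAux (e0 e1 e2 e3 e4 e5 : ℝ → X) (l0 l1 l2 l3 l4 l5 : ℝ) : PrePolygon X 6 :=
  ⟨![e0, e1, e2, e3, e4, e5], ![l0, l1, l2, l3, l4, l5]⟩

/-- The key construction: a fat hexagon from a geodesic `γ` far from a geodesic `β`. -/
lemma hexAux_exists (hX : GeodesicSpace X) {θ ν : ℝ} (hθ : 0 < θ) (hν : 8 ≤ ν)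
    {γ β : ℝ → X} {l L E : ℝ} (hγ : IsGeodesicParam γ l) (hβ : IsGeodesicParam β L)
    (hx : dist (γ 0) (β 0) ≤ E) (hy : dist (γ l) (β L) ≤ E)
    (hl : 2 * E + 3 * (ν * θ) ≤ l)
    (hfar : ∀ s ∈ Set.Icc 0 l, ∀ r ∈ Set.Icc 0 L, 2 * (ν * θ) ≤ dist (γ s) (β r)) :
    ∃ P : PrePolygon X 6, P.IsGeodesicPolygon ∧ P.IsFat2 θ ν ∧
      (∃ s ∈ Set.Icc 0 l, γ s ∈ P.carrier) ∧
      ∃ r1 ∈ Set.Icc 0 L, ∃ r2 ∈ Set.Icc 0 L, β r1 ∈ P.carrier ∧ β r2 ∈ P.carrier ∧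
        l - 2 * E ≤ dist (β r1) (β r2) := by
  set R := ν * θ with hRdef
  have hR : 0 < R := by positivity
  have m0 : (0:ℝ) ∈ Set.Icc 0 l := ⟨le_rfl, hγ.1⟩
  have ml : l ∈ Set.Icc 0 l := ⟨hγ.1, le_rfl⟩
  have n0 : (0:ℝ) ∈ Set.Icc 0 L := ⟨le_rfl, hβ.1⟩
  have nL : L ∈ Set.Icc 0 L := ⟨hβ.1, le_rfl⟩
  have hxy : dist (γ 0) (γ l) = l := by
    rw [hγ.2 0 m0 l ml, zero_sub, abs_neg, abs_of_nonneg hγ.1]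
  obtain ⟨u1, hu1, hu1m⟩ := geoAux_proj hβ (γ 0)
  obtain ⟨u2, hu2, hu2m⟩ := geoAux_proj hβ (γ l)
  obtain ⟨σ1, S1, hσ1, hσ10, hσ1S⟩ := hX (γ 0) (β u1)
  obtain ⟨σ2, S2, hσ2, hσ20, hσ2S⟩ := hX (γ l) (β u2)
  obtain ⟨s1, hs1, q1, hq1, hd1, hc1⟩ := geoAux_cut hγ hσ1 m0 hσ10 hR.le (by
    intro w hw; rw [hσ1S, dist_comm]; linarith [hfar w hw u1 hu1])
  obtain ⟨s2, hs2, q2, hq2, hd2, hc2⟩ := geoAux_cut hγ hσ2 ml hσ20 hR.le (by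
    intro w hw; rw [hσ2S, dist_comm]; linarith [hfar w hw u2 hu2])
  have mS1 : S1 ∈ Set.Icc 0 S1 := ⟨hσ1.1, le_rfl⟩
  have mS2 : S2 ∈ Set.Icc 0 S2 := ⟨hσ2.1, le_rfl⟩
  obtain ⟨e0, l0, g0, a0, b0, c0⟩ := geoAux_sub hβ hu1 hu2
  obtain ⟨e1, l1, g1, a1, b1, c1⟩ := geoAux_sub hσ2 mS2 hs2
  obtain ⟨e2, l2, g2, a2, b2⟩ := hX (σ2 s2) (γ q2)
  obtain ⟨e3, l3, g3, a3, b3, c3⟩ := geoAux_sub hγ hq2 hq1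
  obtain ⟨e4, l4, g4, a4, b4⟩ := hX (γ q1) (σ1 s1)
  obtain ⟨e5, l5, g5, a5, b5, c5⟩ := geoAux_sub hσ1 hs1 mS1
  -- membership descriptions
  have k0 : ∀ s ∈ Set.Icc 0 l0, ∃ r ∈ Set.Icc 0 L, e0 s = β r := by
    intro s hs
    obtain ⟨r, h1, h2, h3⟩ := c0 s hs
    exact ⟨r, ⟨(le_min hu1.1 hu2.1).trans h1, h2.trans (max_le hu1.2 hu2.2)⟩, h3⟩
  have k3 : ∀ s ∈ Set.Icc 0 l3, ∃ r ∈ Set.Icc 0 l, e3 s = γ r := by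
    intro s hs
    obtain ⟨r, h1, h2, h3⟩ := c3 s hs
    exact ⟨r, ⟨(le_min hq2.1 hq1.1).trans h1, h2.trans (max_le hq2.2 hq1.2)⟩, h3⟩
  have k1 : ∀ s ∈ Set.Icc 0 l1, ∃ r ∈ Set.Icc s2 S2, e1 s = σ2 r := by
    intro s hs
    obtain ⟨r, h1, h2, h3⟩ := c1 s hs
    exact ⟨r, ⟨(le_min hs2.2 le_rfl).trans h1, h2.trans (max_le le_rfl hs2.2)⟩, h3⟩
  have k5 : ∀ s ∈ Set.Icc 0 l5, ∃ r ∈ Set.Icc s1 S1, e5 s = σ1 r := by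
    intro s hs
    obtain ⟨r, h1, h2, h3⟩ := c5 s hs
    exact ⟨r, ⟨(le_min le_rfl hs1.2).trans h1, h2.trans (max_le hs1.2 le_rfl)⟩, h3⟩
  -- distances to the projections
  have hE1 : dist (γ 0) (β u1) ≤ E := (hu1m 0 n0).trans hx
  have hE2 : dist (γ l) (β u2) ≤ E := (hu2m L nL).trans hy
  have w1 : ∀ r ∈ Set.Icc 0 S1, dist (γ 0) (σ1 r) ≤ E := by
    intro r hr
    have := geoAux_add hσ1 hr
    rw [hσ10, hσ1S] at this
    linarith [dist_nonneg (x := σ1 r) (y := β u1)]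
  have w2 : ∀ r ∈ Set.Icc 0 S2, dist (γ l) (σ2 r) ≤ E := by
    intro r hr
    have := geoAux_add hσ2 hr
    rw [hσ20, hσ2S] at this
    linarith [dist_nonneg (x := σ2 r) (y := β u2)]
  have v2 : ∀ s ∈ Set.Icc 0 l2, dist (σ2 s2) (e2 s) + dist (e2 s) (γ q2) = R := by
    intro s hs
    have := geoAux_add g2 hs
    rwa [a2, b2, hd2] at this
  have v4 : ∀ s ∈ Set.Icc 0 l4, dist (γ q1) (e4 s) + dist (e4 s) (σ1 s1) = R := by
    intro s hs
    have := geoAux_add g4 hs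
    rwa [a4, b4, dist_comm (γ q1) (σ1 s1), hd1] at this
  have f5 : ∀ s ∈ Set.Icc 0 l5, dist (γ 0) (e5 s) ≤ E := by
    intro s hs
    obtain ⟨r, hr, he⟩ := k5 s hs
    rw [he]; exact w1 r ⟨hs1.1.trans hr.1, hr.2⟩
  have f1 : ∀ s ∈ Set.Icc 0 l1, dist (γ l) (e1 s) ≤ E := by
    intro s hs
    obtain ⟨r, hr, he⟩ := k1 s hs
    rw [he]; exact w2 r ⟨hs2.1.trans hr.1, hr.2⟩
  have f4 : ∀ s ∈ Set.Icc 0 l4, dist (γ 0) (e4 s) ≤ E + R := by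
    intro s hs
    have h1 := v4 s hs
    have h2 := w1 s1 hs1
    have h3 := dist_triangle (γ 0) (σ1 s1) (e4 s)
    rw [dist_comm (σ1 s1)] at h3
    linarith [dist_nonneg (x := γ q1) (y := e4 s)]
  have f2 : ∀ s ∈ Set.Icc 0 l2, dist (γ l) (e2 s) ≤ E + R := by
    intro s hs
    have h1 := v2 s hs
    have h2 := w2 s2 hs2
    have h3 := dist_triangle (γ l) (σ2 s2) (e2 s)
    linarith [dist_nonneg (x := e2 s) (y := γ q2)]
  have far : ∀ p q : X, dist (γ 0) p ≤ E + R → dist (γ l) q ≤ E + R → R ≤ dist q p := by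
    intro p q hp hq
    have h1 := dist_triangle4 (γ 0) p q (γ l)
    rw [dist_comm q (γ l), dist_comm p q] at h1
    linarith
  have hgeo : (hexAux e0 e1 e2 e3 e4 e5 l0 l1 l2 l3 l4 l5).IsGeodesicPolygon := by
    refine ⟨⟨?_, ?_⟩, ?_⟩
    · intro i
      fin_cases i
      exacts [g0.1, g1.1, g2.1, g3.1, g4.1, g5.1]
    · intro i
      fin_cases i
      · show e0 l0 = e1 0
        rw [b0, a1, hσ2S]
      · show e1 l1 = e2 0
        rw [b1, a2]
      · show e2 l2 = e3 0
        rw [b2, a3]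
      · show e3 l3 = e4 0
        rw [b3, a4]
      · show e4 l4 = e5 0
        rw [b4, a5]
      · show e5 l5 = e0 0
        rw [b5, a0, hσ1S]
    · intro i
      fin_cases i
      exacts [g0, g1, g2, g3, g4, g5]
  refine ⟨hexAux e0 e1 e2 e3 e4 e5 l0 l1 l2 l3 l4 l5, hgeo, ?_, ?_, ?_⟩
  · have d02 : ∀ s ∈ Set.Icc 0 l0, ∀ r ∈ Set.Icc 0 l2, R ≤ dist (e0 s) (e2 r) := by
      intro s hs r hr
      obtain ⟨w, hw, he⟩ := k0 s hs
      have h1 := hfar q2 hq2 w hw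
      have h2 := v2 r hr
      have h3 := dist_triangle (γ q2) (e2 r) (β w)
      rw [he, dist_comm (β w)]
      rw [dist_comm (γ q2) (e2 r)] at h3
      linarith [dist_nonneg (x := σ2 s2) (y := e2 r)]
    have d04 : ∀ s ∈ Set.Icc 0 l0, ∀ r ∈ Set.Icc 0 l4, R ≤ dist (e0 s) (e4 r) := by
      intro s hs r hr
      obtain ⟨w, hw, he⟩ := k0 s hs
      have h1 := hfar q1 hq1 w hw
      have h2 := v4 r hr
      have h3 := dist_triangle (γ q1) (e4 r) (β w)
      rw [he, dist_comm (β w)]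
      linarith [dist_nonneg (x := e4 r) (y := σ1 s1)]
    have d03 : ∀ s ∈ Set.Icc 0 l0, ∀ r ∈ Set.Icc 0 l3, R ≤ dist (e0 s) (e3 r) := by
      intro s hs r hr
      obtain ⟨w, hw, he⟩ := k0 s hs
      obtain ⟨w', hw', he'⟩ := k3 r hr
      rw [he, he', dist_comm]
      linarith [hfar w' hw' w hw]
    have d13 : ∀ s ∈ Set.Icc 0 l1, ∀ r ∈ Set.Icc 0 l3, R ≤ dist (e1 s) (e3 r) := by
      intro s hs r hr
      obtain ⟨w, hw, he⟩ := k1 s hs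
      obtain ⟨w', hw', he'⟩ := k3 r hr
      rw [he, he']
      exact hc2 w hw w' hw'
    have d35 : ∀ s ∈ Set.Icc 0 l3, ∀ r ∈ Set.Icc 0 l5, R ≤ dist (e3 s) (e5 r) := by
      intro s hs r hr
      obtain ⟨w, hw, he⟩ := k5 r hr
      obtain ⟨w', hw', he'⟩ := k3 s hs
      rw [he, he', dist_comm]
      exact hc1 w hw w' hw'
    have d14 : ∀ s ∈ Set.Icc 0 l1, ∀ r ∈ Set.Icc 0 l4, R ≤ dist (e1 s) (e4 r) :=
      fun s hs r hr => far _ _ (f4 r hr) (by linarith [f1 s hs])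
    have d15 : ∀ s ∈ Set.Icc 0 l1, ∀ r ∈ Set.Icc 0 l5, R ≤ dist (e1 s) (e5 r) :=
      fun s hs r hr => far _ _ (by linarith [f5 r hr]) (by linarith [f1 s hs])
    have d24 : ∀ s ∈ Set.Icc 0 l2, ∀ r ∈ Set.Icc 0 l4, R ≤ dist (e2 s) (e4 r) :=
      fun s hs r hr => far _ _ (f4 r hr) (f2 s hs)
    have d25 : ∀ s ∈ Set.Icc 0 l2, ∀ r ∈ Set.Icc 0 l5, R ≤ dist (e2 s) (e5 r) :=
      fun s hs r hr => far _ _ (by linarith [f5 r hr]) (f2 s hs)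
    have p01 : ∀ s ∈ Set.Icc 0 l0, ∀ r ∈ Set.Icc 0 l1, dist (e1 r) (e1 0) ≤ dist (e0 s) (e1 r) := by
      intro s hs r hr
      obtain ⟨w, hw, he⟩ := k0 s hs
      obtain ⟨w', hw', he'⟩ := k1 r hr
      have h1 := geoAux_add hσ2 (s := w') ⟨hs2.1.trans hw'.1, hw'.2⟩
      rw [dist_comm (e0 s), a1, he, he', hσ2S]
      rw [hσ2S, hσ20] at h1
      exact geoAux_perp h1 (hu2m w hw)
    have p12 : ∀ s ∈ Set.Icc 0 l1, ∀ r ∈ Set.Icc 0 l2, dist (e2 r) (e2 0) ≤ dist (e1 s) (e2 r) := by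
      intro s hs r hr
      obtain ⟨w, hw, he⟩ := k1 s hs
      have h1 := v2 r hr
      rw [dist_comm (e1 s), a2, he]
      refine geoAux_perp (a := γ q2) ?_ ?_
      · rw [dist_comm (γ q2) (σ2 s2), hd2, dist_comm (γ q2), dist_comm (e2 r) (σ2 s2)]
        linarith
      · rw [dist_comm (γ q2) (σ2 s2), hd2, dist_comm]
        exact hc2 w hw q2 hq2
    have p23 : ∀ s ∈ Set.Icc 0 l2, ∀ r ∈ Set.Icc 0 l3, dist (e2 s) (e3 0) ≤ dist (e2 s) (e3 r) := by
      intro s hs r hr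
      obtain ⟨w, hw, he⟩ := k3 r hr
      have h1 := v2 s hs
      rw [a3, he]
      refine geoAux_perp (a := σ2 s2) ?_ ?_
      · rw [hd2]; exact h1
      · rw [hd2]; exact hc2 s2 ⟨le_rfl, hs2.2⟩ w hw
    have p34 : ∀ s ∈ Set.Icc 0 l3, ∀ r ∈ Set.Icc 0 l4, dist (e4 r) (e4 0) ≤ dist (e3 s) (e4 r) := by
      intro s hs r hr
      obtain ⟨w, hw, he⟩ := k3 s hs
      have h1 := v4 r hr
      rw [dist_comm (e3 s), a4, he]
      refine geoAux_perp (a := σ1 s1) ?_ ?_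
      · rw [hd1, dist_comm (σ1 s1), dist_comm (e4 r) (γ q1)]
        linarith
      · rw [hd1]; exact hc1 s1 ⟨le_rfl, hs1.2⟩ w hw
    have p45 : ∀ s ∈ Set.Icc 0 l4, ∀ r ∈ Set.Icc 0 l5, dist (e4 s) (e5 0) ≤ dist (e4 s) (e5 r) := by
      intro s hs r hr
      obtain ⟨w, hw, he⟩ := k5 r hr
      have h1 := v4 s hs
      rw [a5, he]
      refine geoAux_perp (a := γ q1) ?_ ?_
      · rw [dist_comm (γ q1) (σ1 s1), hd1]; exact h1
      · rw [dist_comm (γ q1) (σ1 s1), hd1, dist_comm]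
        exact hc1 w hw q1 hq1
    have p50 : ∀ s ∈ Set.Icc 0 l5, ∀ r ∈ Set.Icc 0 l0, dist (e5 s) (e0 0) ≤ dist (e5 s) (e0 r) := by
      intro s hs r hr
      obtain ⟨w, hw, he⟩ := k0 r hr
      obtain ⟨w', hw', he'⟩ := k5 s hs
      have h1 := geoAux_add hσ1 (s := w') ⟨hs1.1.trans hw'.1, hw'.2⟩
      rw [a0, he, he']
      rw [hσ1S, hσ10] at h1
      exact geoAux_perp h1 (hu1m w hw)
    refine hexAux_fat _ hgeo hθ hν ?_ ?_
    · rintro i j hij h1 h2 _ ⟨s, hs, rfl⟩ _ ⟨r, hr, rfl⟩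
      fin_cases i <;> fin_cases j <;> first
        | exact absurd hij (by decide)
        | exact absurd rfl h1
        | exact absurd rfl h2
        | exact d02 s hs r hr
        | exact d03 s hs r hr
        | exact d04 s hs r hr
        | exact d13 s hs r hr
        | exact d14 s hs r hr
        | exact d15 s hs r hr
        | exact d24 s hs r hr
        | exact d25 s hs r hr
        | exact d35 s hs r hr
    · intro i
      fin_cases i
      · right; rintro _ ⟨s, hs, rfl⟩ _ ⟨r, hr, rfl⟩; exact p01 s hs r hr
      · right; rintro _ ⟨s, hs, rfl⟩ _ ⟨r, hr, rfl⟩; exact p12 s hs r hr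
      · left; rintro _ ⟨s, hs, rfl⟩ _ ⟨r, hr, rfl⟩; exact p23 s hs r hr
      · right; rintro _ ⟨s, hs, rfl⟩ _ ⟨r, hr, rfl⟩; exact p34 s hs r hr
      · left; rintro _ ⟨s, hs, rfl⟩ _ ⟨r, hr, rfl⟩; exact p45 s hs r hr
      · left; rintro _ ⟨s, hs, rfl⟩ _ ⟨r, hr, rfl⟩; exact p50 s hs r hr
  · refine ⟨q2, hq2, Set.mem_iUnion.2 ⟨3, 0, ⟨le_rfl, g3.1⟩, a3⟩⟩
  · refine ⟨u1, hu1, u2, hu2, Set.mem_iUnion.2 ⟨0, 0, ⟨le_rfl, g0.1⟩, a0⟩,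
      Set.mem_iUnion.2 ⟨0, l0, ⟨g0.1, le_rfl⟩, b0⟩, ?_⟩
    have h1 := dist_triangle4 (γ 0) (β u1) (β u2) (γ l)
    rw [dist_comm (β u2) (γ l)] at h1
    linarith

/-- (α₂) with uniform constant for all `ε < 1/10`. -/
lemma alpha2Aux (hX : GeodesicSpace X) (𝓐 : Set (Set X))
    (h1 : Alpha1 𝓐) (hQ : PropQ 𝓐) (h3 : Beta3 𝓐) :
    ∃ M : ℝ, 0 < M ∧ ∀ ε : ℝ, 0 < ε → ε < 1 / 10 → Alpha2With 𝓐 ε M := by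
  obtain ⟨t, ht, K₀, hK₀, hQ⟩ := hQ
  obtain ⟨θ, hθ, ν, hν, χ, hχ, h3⟩ := h3
  set T := t * (K₀ + 1) with hT
  have hTp : 0 < T := by positivity
  obtain ⟨D, hD⟩ := h1 (χ + T) (by positivity)
  set R := ν * θ with hRdef
  have hR : 0 < R := by positivity
  have hD' := le_abs_self D
  have hD'' := abs_nonneg D
  refine ⟨T + 2 * R + χ + |D| + 1, by positivity, ?_⟩
  intro ε hε hε1 γ l hγ A hA hx hy
  set M := T + 2 * R + χ + |D| + 1 with hM
  have hMp : 0 < M := by positivity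
  rcases A.eq_empty_or_nonempty with hAe | hAne
  · refine ⟨0, ⟨le_rfl, hγ.1⟩, ?_⟩
    simp only [tubN, hAe, Metric.infDist_empty, Set.mem_ofPred_eq]
    exact hMp
  by_contra hcon
  push Not at hcon
  have hfarA : ∀ s ∈ Set.Icc 0 l, M ≤ Metric.infDist (γ s) A := by
    intro s hs
    have := hcon s hs
    simpa [tubN] using this
  have hx' : Metric.infDist (γ 0) A < ε * l := hx
  have hy' : Metric.infDist (γ l) A < ε * l := hy
  obtain ⟨x', hx'A, hxd⟩ := (Metric.infDist_lt_iff hAne).1 hx'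
  obtain ⟨y', hy'A, hyd⟩ := (Metric.infDist_lt_iff hAne).1 hy'
  have hl0 := hγ.1
  have hMl : M < ε * l := (hfarA 0 ⟨le_rfl, hl0⟩).trans_lt hx'
  have hεl : ε * l ≤ 1 / 10 * l := by nlinarith
  obtain ⟨β, L, hβ, hβ0, hβL⟩ := hX x' y'
  have hβA : ∀ r ∈ Set.Icc 0 L, Metric.infDist (β r) A < T := by
    intro r hr
    refine hQ A hA (K₀ + 1) (by linarith) β L hβ ?_ ?_ r hr
    · simp only [tubN, Set.mem_ofPred_eq, hβ0, Metric.infDist_zero_of_mem hx'A]; linarith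
    · simp only [tubN, Set.mem_ofPred_eq, hβL, Metric.infDist_zero_of_mem hy'A]; linarith
  obtain ⟨P, hP, hPf, ⟨s, hs, hsP⟩, r1, hr1, r2, hr2, hr1P, hr2P, hrd⟩ :=
    hexAux_exists hX (E := ε * l) hθ hν hγ hβ (by rw [hβ0]; exact hxd.le)
      (by rw [hβL]; exact hyd.le) (by linarith) (by
        intro s hs r hr
        have e1 := hfarA s hs
        have e2 := hβA r hr
        have e3 := Metric.infDist_le_infDist_add_dist (s := A) (x := γ s) (y := β r)
        linarith)
  obtain ⟨A', hA', hPA⟩ := h3 P hP hPf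
  have hAA : A = A' := by
    by_contra hne
    have k : ∀ r ∈ Set.Icc 0 L, β r ∈ P.carrier → β r ∈ tubN (χ + T) A ∩ tubN (χ + T) A' := by
      intro r hr hrP
      have e1 := hβA r hr
      have e2 : Metric.infDist (β r) A' < χ := hPA hrP
      exact ⟨tubAux_mem (by linarith), tubAux_mem (by linarith)⟩
    have := hD A hA A' hA' hne _ (k r1 hr1 hr1P) _ (k r2 hr2 hr2P)
    linarith
  subst hAA
  have e1 : Metric.infDist (γ s) A < χ := hPA hsP
  have e2 := hfarA s hs
  linarith

/-- **Lemma.** Properties (α₁), (Q) and (β₃) imply property (α₂) for all sufficiently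
small `ε > 0` (with a suitable constant `M` depending on `ε`), as well as (β₂). -/
theorem alpha2_beta2_of_alpha1_q_beta3 (hX : GeodesicSpace X) (𝓐 : Set (Set X))
    (h1 : Alpha1 𝓐) (hQ : PropQ 𝓐) (h3 : Beta3 𝓐) :
    (∃ ε₀ : ℝ, 0 < ε₀ ∧ ∀ ε : ℝ, 0 < ε → ε < ε₀ →
      ∃ M : ℝ, 0 < M ∧ Alpha2With 𝓐 ε M) ∧ Beta2 𝓐 := by
  
  obtain ⟨M, hM, hα⟩ := alpha2Aux hX 𝓐 h1 hQ h3
  refine ⟨⟨1 / 10, by norm_num, fun ε h0 hε => ⟨M, hM, hα ε h0 hε⟩⟩, ?_⟩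
  obtain ⟨t, ht, K₀, hK₀, hQ⟩ := hQ
  have hα' := hα (1 / 20) (by norm_num) (by norm_num)
  -- a small constant
  set ε : ℝ := 1 / (60 * (t + 1)) with hε
  have hεp : 0 < ε := by positivity
  have hεt : ε * (t + 1) = 1 / 60 := by rw [hε]; field_simp
  refine ⟨ε, t * (M + K₀), hεp, by positivity, ?_⟩
  intro γ l hγ A hA hx hy s hs
  have hl := hγ.1
  have hs0 : 0 ≤ s := by linarith [hs.1]
  have hsl : s ≤ l := by linarith [hs.2]
  have hx' : Metric.infDist (γ 0) A < ε * l := hx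
  have hy' : Metric.infDist (γ l) A < ε * l := hy
  rcases le_total (ε * l) K₀ with hc | hc
  · exact hQ A hA (M + K₀) (by linarith) γ l hγ (tubAux_mem (by linarith))
      (tubAux_mem (by linarith)) s ⟨hs0, hsl⟩
  have hz : Metric.infDist (γ s) A < t * (ε * l) := hQ A hA (ε * l) hc γ l hγ hx hy s ⟨hs0, hsl⟩
  have hz' : t * (ε * l) + ε * l = 1 / 60 * l := by rw [← hεt]; ring
  have hp1 : 0 ≤ t * (ε * l) := by positivity
  have hp2 : 0 ≤ ε * l := by positivity
  -- left half
  obtain ⟨t1, ht1, hm1⟩ := hα' γ s ⟨hs0, fun a ha b hb =>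
      hγ.2 a ⟨ha.1, ha.2.trans hsl⟩ b ⟨hb.1, hb.2.trans hsl⟩⟩ A hA
    (tubAux_mem (by linarith [hs.1])) (tubAux_mem (by linarith [hs.1]))
  -- right half
  obtain ⟨t2, ht2, hm2⟩ := hα' (fun r => γ (s + r)) (l - s) ⟨by linarith, fun a ha b hb => by
      have := hγ.2 (s + a) ⟨by linarith [ha.1], by linarith [ha.2]⟩ (s + b)
        ⟨by linarith [hb.1], by linarith [hb.2]⟩
      simp only [this]
      congr 1; ring⟩ A hA
    (show Metric.infDist (γ (s + 0)) A < _ by rw [add_zero]; linarith [hs.2])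
    (show Metric.infDist (γ (s + (l - s))) A < _ by rw [add_sub_cancel]; linarith [hs.2])
  have hm1' : Metric.infDist (γ t1) A < M := hm1
  have hm2' : Metric.infDist (γ (s + t2)) A < M := hm2
  have := hQ A hA (M + K₀) (by linarith) (fun r => γ (t1 + r)) (s + t2 - t1)
    ⟨by linarith [ht1.2, ht2.1], fun a ha b hb => by
      have := hγ.2 (t1 + a) ⟨by linarith [ha.1, ht1.1], by linarith [ha.2, ht2.2]⟩ (t1 + b)
        ⟨by linarith [hb.1, ht1.1], by linarith [hb.2, ht2.2]⟩
      simp only [this]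
      congr 1; ring⟩
    (show Metric.infDist (γ (t1 + 0)) A < _ by rw [add_zero]; linarith)
    (show Metric.infDist (γ (t1 + (s + t2 - t1))) A < _ by rw [add_sub_cancel]; linarith)
    (s - t1) ⟨by linarith [ht1.2], by linarith [ht2.1]⟩
  simpa using this
end
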